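/- There is an isomorphism of graded ℂ-algebras ℂ[X₁,X₂,X₃]/(X₁X₂+X₂X₃+X₃X₁) ≅ ⨁_{k≥0} M_k(Γ₁(7);ℂ), where the polynomial ring carries the grading by total degree with each X_i of degree 1, the right-hand side is the graded ring of holomorphic modular forms for Γ₁(7) under pointwise multiplication, and the isomorphism maps the degree-k part onto M_k(Γ₁(7);ℂ) for every k. In particular dim_ℂ M_k(Γ₁(7);ℂ) = 2k+1 for all k ≥ 0. -/

import Mathlib

open MvPolynomial
open scoped DirectSum

/-- triangular families are linearly independent -/
lemma tri_linearIndependent {ι V : Type*} [AddCommGroup V] [Module ℂ V] (v : ι → V)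
    (lam : ι → V →ₗ[ℂ] ℂ) (deg : ι → ℕ) (h1 : ∀ p, lam p (v p) = 1)
    (h0 : ∀ p p', p ≠ p' → deg p ≤ deg p' → lam p (v p') = 0) : LinearIndependent ℂ v := by
  classical
  rw [linearIndependent_iff]
  intro l hl
  by_contra hne
  have hs : l.support.Nonempty := Finsupp.support_nonempty_iff.mpr hne
  obtain ⟨p, hp, hmin⟩ := Finset.exists_min_image l.support deg hs
  have := congrArg (lam p) hl
  rw [Finsupp.linearCombination_apply, Finsupp.sum, map_sum, map_zero,
    Finset.sum_eq_single p] at this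
  · simp [h1] at this
    simp [this] at hp
  · intro b hb hbp
    rw [map_smul, h0 p b (Ne.symm hbp) (hmin b hb), smul_zero]
  · intro h; exact absurd hp h

/-- normal form monomials -/
def nf {S : Type*} [CommRing S] (a b c : S) (k j : ℕ) : S :=
  if j ≤ k then a ^ (k - j) * b ^ j else b ^ (2 * k - j) * c ^ (j - k)

lemma nf_map {S T : Type*} [CommRing S] [CommRing T] (f : S →+* T) (a b c : S) (k j : ℕ) :
    f (nf a b c k j) = nf (f a) (f b) (f c) k j := by
  unfold nf; split_ifs <;> simp

lemma nf_a {S : Type*} [CommRing S] {a b c : S} (h : a * c = b ^ 2) {k j : ℕ} (hj : j ≤ 2 * k) :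
    a * nf a b c k j = nf a b c (k + 1) j := by
  unfold nf
  by_cases h1 : j ≤ k
  · rw [if_pos h1, if_pos (by omega), Nat.sub_add_comm h1]; ring
  · rw [if_neg h1]
    by_cases h2 : j = k + 1
    · subst h2
      rw [if_pos le_rfl]
      have e1 : k + 1 - k = 1 := by omega
      have e2 : 2 * k - (k + 1) + 2 = k + 1 := by omega
      simp only [e1, pow_one, Nat.sub_self, pow_zero, one_mul]
      have e3 : b ^ (k + 1) = b ^ (2 * k - (k + 1)) * b ^ 2 := by rw [← pow_add, e2]
      rw [e3, ← h]; ring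
    · rw [if_neg (by omega)]
      have e1 : j - k = (j - (k + 1)) + 1 := by omega
      have e2 : 2 * (k + 1) - j = 2 * k - j + 2 := by omega
      rw [e1, e2, pow_add b, ← h]; ring

lemma nf_b {S : Type*} [CommRing S] {a b c : S} {k j : ℕ} (hj : j ≤ 2 * k) :
    b * nf a b c k j = nf a b c (k + 1) (j + 1) := by
  unfold nf
  by_cases h1 : j ≤ k
  · rw [if_pos h1, if_pos (by omega), Nat.add_sub_add_right]; ring
  · rw [if_neg h1, if_neg (by omega), Nat.add_sub_add_right]
    have e2 : 2 * (k + 1) - (j + 1) = 2 * k - j + 1 := by omega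
    rw [e2]; ring

lemma nf_c {S : Type*} [CommRing S] {a b c : S} (h : a * c = b ^ 2) {k j : ℕ} (hj : j ≤ 2 * k) :
    c * nf a b c k j = nf a b c (k + 1) (j + 2) := by
  unfold nf
  by_cases h1 : j + 1 ≤ k
  · rw [if_pos (by omega), if_pos (by omega)]
    have e1 : k - j = (k + 1 - (j + 2)) + 1 := by omega
    rw [e1, pow_add b, ← h]; ring
  · by_cases h2 : j = k
    · subst h2
      rw [if_pos le_rfl, if_neg (by omega)]
      have e2 : 2 * (j + 1) - (j + 2) = j := by omega
      have e3 : j + 2 - (j + 1) = 1 := by omega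
      rw [e2, e3, Nat.sub_self]; ring
    · rw [if_neg (by omega), if_neg (by omega)]
      have e2 : 2 * (k + 1) - (j + 2) = 2 * k - j := by omega
      have e3 : j + 2 - (k + 1) = j - k + 1 := by omega
      rw [e2, e3]; ring

lemma nf_mem {R : Type*} [CommRing R] [Algebra ℂ R] (𝒜 : ℕ → Submodule ℂ R)
    (hone : 1 ∈ 𝒜 0) (hmul : ∀ m n x y, x ∈ 𝒜 m → y ∈ 𝒜 n → x * y ∈ 𝒜 (m + n))
    {a b c : R} (ha : a ∈ 𝒜 1) (hb : b ∈ 𝒜 1) (hc : c ∈ 𝒜 1) {k j : ℕ} (hj : j ≤ 2 * k) :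
    nf a b c k j ∈ 𝒜 k := by
  have hp : ∀ x ∈ 𝒜 1, ∀ n, x ^ n ∈ 𝒜 n := by
    intro x hx n
    induction n with
    | zero => simpa using hone
    | succ n ih => rw [pow_succ]; exact hmul _ _ _ _ ih hx
  unfold nf
  split_ifs with h
  · have := hmul _ _ _ _ (hp a ha (k - j)) (hp b hb j)
    rwa [Nat.sub_add_cancel h] at this
  · have := hmul _ _ _ _ (hp b hb (2 * k - j)) (hp c hc (j - k))
    rwa [show 2 * k - j + (j - k) = k by omega] at this

/-- index type for normal forms -/
abbrev NFI := {p : ℕ × ℕ // p.2 ≤ 2 * p.1}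

theorem abstract_presentation {R : Type*} [CommRing R] [Algebra ℂ R] (𝒜 : ℕ → Submodule ℂ R)
    (hone : 1 ∈ 𝒜 0) (hmul : ∀ m n x y, x ∈ 𝒜 m → y ∈ 𝒜 n → x * y ∈ 𝒜 (m + n))
    (htop : ⨆ k, 𝒜 k = ⊤) (π : ℕ → R →ₗ[ℂ] R) (hπ : ∀ k, ∀ x ∈ 𝒜 k, π k x = x)
    (hπ' : ∀ k l, k ≠ l → ∀ x ∈ 𝒜 l, π k x = 0)
    (q : R →ₐ[ℂ] PowerSeries ℂ)
    (sturm : ∀ k, ∀ x ∈ 𝒜 k, (∀ i ≤ 2 * k, (q x).coeff i = 0) → x = 0)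
    (three : 3 ≤ Module.finrank ℂ (𝒜 1)) :
    (∃ ψ : (MvPolynomial (Fin 3) ℂ ⧸
        (Ideal.span {(X 0 * X 1 + X 1 * X 2 + X 2 * X 0 : MvPolynomial (Fin 3) ℂ)}))
        ≃ₐ[ℂ] R,
      (∀ (k : ℕ) (f : MvPolynomial (Fin 3) ℂ), f.IsHomogeneous k →
        ψ (Ideal.Quotient.mk _ f) ∈ 𝒜 k) ∧
      (∀ (k : ℕ), ∀ g ∈ 𝒜 k,
        ∃ f : MvPolynomial (Fin 3) ℂ, f.IsHomogeneous k ∧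
          ψ (Ideal.Quotient.mk _ f) = g)) ∧
    ∀ k : ℕ, Module.finrank ℂ (𝒜 k) = 2 * k + 1 := by
  let cf : ∀ k, 𝒜 k →ₗ[ℂ] (Fin (2 * k + 1) → ℂ) := fun k =>
    LinearMap.pi fun i => (PowerSeries.coeff (i : ℕ)).comp (q.toLinearMap.comp (𝒜 k).subtype)
  have cf_apply : ∀ k (x : 𝒜 k) i, cf k x i = (q x).coeff (i : ℕ) := fun k x i => rfl
  have cf_inj : ∀ k, Function.Injective (cf k) := by
    intro k
    rw [← LinearMap.ker_eq_bot, LinearMap.ker_eq_bot']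
    intro x hx
    ext
    refine sturm k x x.2 fun i hi => ?_
    exact congrFun hx ⟨i, by omega⟩
  have fd : ∀ k, FiniteDimensional ℂ (𝒜 k) := fun k =>
    FiniteDimensional.of_injective (cf k) (cf_inj k)
  have fr : ∀ k, Module.finrank ℂ (𝒜 k) ≤ 2 * k + 1 := fun k => by
    simpa using LinearMap.finrank_le_finrank_of_injective (cf_inj k)
  have cf1 : Function.Surjective (cf 1) := by
    have : Module.finrank ℂ (𝒜 1) = Module.finrank ℂ (Fin (2 * 1 + 1) → ℂ) := by
      have := fr 1
      simp; omega
    exact (LinearMap.injective_iff_surjective_of_finrank_eq_finrank this).mp (cf_inj 1)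
  obtain ⟨f0, hf0⟩ := cf1 ![1, 0, 0]
  obtain ⟨f1, hf1⟩ := cf1 ![0, 1, 0]
  obtain ⟨f2, hf2⟩ := cf1 ![0, 0, 1]
  have g00 : (q f0).coeff 0 = 1 := congrFun hf0 0
  have g01 : (q f0).coeff 1 = 0 := congrFun hf0 1
  have g02 : (q f0).coeff 2 = 0 := congrFun hf0 2
  have g10 : (q f1).coeff 0 = 0 := congrFun hf1 0
  have g11 : (q f1).coeff 1 = 1 := congrFun hf1 1
  have g12 : (q f1).coeff 2 = 0 := congrFun hf1 2
  have g20 : (q f2).coeff 0 = 0 := congrFun hf2 0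
  have g21 : (q f2).coeff 1 = 0 := congrFun hf2 1
  have g22 : (q f2).coeff 2 = 1 := congrFun hf2 2
  obtain ⟨a, ha, b, hb, c, hc, habc, ⟨pa, hpa, hpa0⟩, ⟨pb, hpb, hpb0⟩, ⟨pc, hpc, hpc0⟩⟩ :
      ∃ a ∈ 𝒜 1, ∃ b ∈ 𝒜 1, ∃ c ∈ 𝒜 1, a * c = b ^ 2 ∧
        (∃ p : PowerSeries ℂ, q a = p ∧ PowerSeries.constantCoeff p = 1) ∧
        (∃ p : PowerSeries ℂ, q b = PowerSeries.X * p ∧ PowerSeries.constantCoeff p = 1) ∧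
        (∃ p : PowerSeries ℂ, q c = PowerSeries.X ^ 2 * p ∧ PowerSeries.constantCoeff p = 1) := by
    obtain ⟨p1, hp1⟩ : PowerSeries.X ∣ q f1 := by
      rw [PowerSeries.X_dvd_iff]; simpa using g10
    obtain ⟨p2, hp2⟩ : PowerSeries.X ^ 2 ∣ q f2 := by
      rw [PowerSeries.X_pow_dvd_iff]; intro m hm; interval_cases m <;> assumption
    have c1 : PowerSeries.constantCoeff p1 = 1 := by
      rw [hp1, show (1 : ℕ) = 0 + 1 from rfl, PowerSeries.coeff_succ_X_mul] at g11
      simpa using g11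
    have c2 : PowerSeries.constantCoeff p2 = 1 := by
      rw [hp2, show (2 : ℕ) = 0 + 2 from rfl, PowerSeries.coeff_X_pow_mul] at g22
      simpa using g22
    set al : ℂ := ((q f0 * q f2 - q f1 ^ 2).coeff 3) with hal
    set be : ℂ := ((q f0 * q f2 - q f1 ^ 2 - al • (q f1 * q f2)).coeff 4) with hbe
    have key : (f0 : R) * f2 - (f1 : R) ^ 2 - al • ((f1 : R) * f2) - be • ((f2 : R) ^ 2) = 0 := by
      apply sturm 2
      · refine Submodule.sub_mem _ (Submodule.sub_mem _ (Submodule.sub_mem _ ?_ ?_) ?_) ?_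
        · exact hmul 1 1 _ _ f0.2 f2.2
        · rw [pow_two]; exact hmul 1 1 _ _ f1.2 f1.2
        · exact Submodule.smul_mem _ _ (hmul 1 1 _ _ f1.2 f2.2)
        · rw [pow_two]; exact Submodule.smul_mem _ _ (hmul 1 1 _ _ f2.2 f2.2)
      · intro i hi
        have A12 : ∀ i, (q f1 * q f2).coeff (i + 3) = (p1 * p2).coeff i := by
          intro i
          rw [hp1, hp2, show PowerSeries.X * p1 * (PowerSeries.X ^ 2 * p2)
            = PowerSeries.X ^ 3 * (p1 * p2) by ring, PowerSeries.coeff_X_pow_mul]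
        have A12' : ∀ i < 3, (q f1 * q f2).coeff i = 0 := by
          intro i hi
          rw [hp1, hp2, show PowerSeries.X * p1 * (PowerSeries.X ^ 2 * p2)
            = PowerSeries.X ^ 3 * (p1 * p2) by ring, PowerSeries.coeff_X_pow_mul', if_neg (by omega)]
        have A22 : ∀ i, (q f2 ^ 2).coeff (i + 4) = (p2 ^ 2).coeff i := by
          intro i
          rw [hp2, show (PowerSeries.X ^ 2 * p2) ^ 2
            = PowerSeries.X ^ 4 * (p2 ^ 2) by ring, PowerSeries.coeff_X_pow_mul]
        have A22' : ∀ i < 4, (q f2 ^ 2).coeff i = 0 := by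
          intro i hi
          rw [hp2, show (PowerSeries.X ^ 2 * p2) ^ 2
            = PowerSeries.X ^ 4 * (p2 ^ 2) by ring, PowerSeries.coeff_X_pow_mul', if_neg (by omega)]
        have B : ∀ i < 3, (q f0 * q f2 - q f1 ^ 2).coeff i = 0 := by
          intro i hi
          rw [hp1, hp2, show q f0 * (PowerSeries.X ^ 2 * p2) - (PowerSeries.X * p1) ^ 2
            = PowerSeries.X ^ 2 * (q f0 * p2 - p1 ^ 2) by ring, PowerSeries.coeff_X_pow_mul']
          split_ifs with h
          · obtain rfl : i = 2 := by omega
            simp [c1, c2, ← PowerSeries.coeff_zero_eq_constantCoeff_apply (q f0), g00]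
          · rfl
        have C12 : (q f1 * q f2).coeff 3 = 1 := by
          rw [show (3 : ℕ) = 0 + 3 from rfl, A12]; simp [c1, c2]
        have C22 : (q f2 ^ 2).coeff 4 = 1 := by
          rw [show (4 : ℕ) = 0 + 4 from rfl, A22]; simp [c2]
        have hq : q ((f0 : R) * f2 - (f1 : R) ^ 2 - al • ((f1 : R) * f2) - be • ((f2 : R) ^ 2))
            = (q f0 * q f2 - q f1 ^ 2 - al • (q f1 * q f2)) - be • (q f2 ^ 2) := by
          simp only [map_sub, map_mul, map_pow, map_smul]
        rw [hq]
        have hi' : i ≤ 4 := hi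
        by_cases h4 : i = 4
        · subst h4
          rw [map_sub, PowerSeries.coeff_smul, C22, ← hbe]; simp
        by_cases h3 : i = 3
        · subst h3
          rw [map_sub, map_sub, PowerSeries.coeff_smul, PowerSeries.coeff_smul, C12,
            A22' 3 (by norm_num), ← hal]; simp
        · rw [map_sub, map_sub, PowerSeries.coeff_smul, PowerSeries.coeff_smul,
            A12' i (by omega), A22' i (by omega), B i (by omega)]
          simp
    refine ⟨f0 - al • f1 - be • f2, ?_, f1, f1.2, f2, f2.2, ?_, ⟨_, rfl, ?_⟩, ⟨p1, hp1, c1⟩,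
      ⟨p2, hp2, c2⟩⟩
    · exact Submodule.sub_mem _ (Submodule.sub_mem _ f0.2 (Submodule.smul_mem _ _ f1.2))
        (Submodule.smul_mem _ _ f2.2)
    · rw [← sub_eq_zero, ← key]
      simp only [sub_mul, smul_mul_assoc, pow_two]
      abel
    · rw [← PowerSeries.coeff_zero_eq_constantCoeff_apply]
      simp only [map_sub, map_smul, g00, g10, g20]; simp
  have qnf : ∀ k j, j ≤ 2 * k → ∃ p : PowerSeries ℂ, q (nf a b c k j) = PowerSeries.X ^ j * p ∧
      PowerSeries.constantCoeff p = 1 := by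
    intro k j hj
    have := nf_map (q : R →+* PowerSeries ℂ) a b c k j
    simp only [RingHom.coe_coe] at this
    rw [this, hpa, hpb, hpc]
    unfold nf
    split_ifs with h
    · exact ⟨pa ^ (k - j) * pb ^ j, by ring, by simp [hpa0, hpb0]⟩
    · refine ⟨pb ^ (2 * k - j) * pc ^ (j - k), ?_, by simp [hpb0, hpc0]⟩
      rw [mul_pow, mul_pow, ← pow_mul]
      rw [show PowerSeries.X ^ j = (PowerSeries.X : PowerSeries ℂ) ^ (2 * k - j)
        * PowerSeries.X ^ (2 * (j - k)) by rw [← pow_add]; congr 1; omega]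
      ring
  have mem_nf : ∀ k j, j ≤ 2 * k → nf a b c k j ∈ 𝒜 k := fun k j hj =>
    nf_mem 𝒜 hone hmul ha hb hc hj
  have li : LinearIndependent ℂ (fun p : NFI => nf a b c p.1.1 p.1.2) := by
    refine tri_linearIndependent _
      (fun p => (PowerSeries.coeff p.1.2).comp (q.toLinearMap.comp (π p.1.1)))
      (fun p => p.1.2) ?_ ?_
    · rintro ⟨⟨k, j⟩, hj⟩
      obtain ⟨p, hp, hp0⟩ := qnf k j hj
      simp only [LinearMap.comp_apply, AlgHom.toLinearMap_apply]
      rw [hπ k _ (mem_nf k j hj), hp, PowerSeries.coeff_X_pow_mul']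
      simpa using hp0
    · rintro ⟨⟨k, j⟩, hj⟩ ⟨⟨k', j'⟩, hj'⟩ hne hle
      simp only [LinearMap.comp_apply, AlgHom.toLinearMap_apply]
      by_cases hk : k = k'
      · subst hk
        obtain ⟨p, hp, hp0⟩ := qnf k j' hj'
        have hle' : j ≤ j' := hle
        have hjj : j ≠ j' := by rintro rfl; exact hne rfl
        rw [hπ k _ (mem_nf k j' hj'), hp, PowerSeries.coeff_X_pow_mul', if_neg (by omega)]
      · rw [hπ' k k' hk _ (mem_nf k' j' hj')]; simp
  have lik : ∀ k, LinearIndependent ℂ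
      (fun j : Fin (2 * k + 1) => (⟨nf a b c k j, mem_nf k j (by omega)⟩ : 𝒜 k)) := by
    intro k
    apply LinearIndependent.of_comp (𝒜 k).subtype
    exact li.comp (fun j : Fin (2 * k + 1) => (⟨(k, j), by simp; omega⟩ : NFI))
      (fun j j' h => by simpa [Fin.ext_iff] using h)
  have frk : ∀ k, Module.finrank ℂ (𝒜 k) = 2 * k + 1 := by
    intro k
    have := (lik k).fintype_card_le_finrank
    simp at this
    have := fr k
    omega
  have spk : ∀ k, Submodule.span ℂ
      (Set.range (fun j : Fin (2 * k + 1) => (⟨nf a b c k j, mem_nf k j (by omega)⟩ : 𝒜 k))) = ⊤ := by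
    intro k
    exact (lik k).span_eq_top_of_card_eq_finrank' (by simp [frk k])
  set I := Ideal.span {(X 0 * X 1 + X 1 * X 2 + X 2 * X 0 : MvPolynomial (Fin 3) ℂ)} with hI
  let Ψ : MvPolynomial (Fin 3) ℂ →ₐ[ℂ] R := aeval ![b + c, a + b, -b]
  have hΨ : ∀ x ∈ I, Ψ x = 0 := by
    intro x hx
    have : I ≤ RingHom.ker Ψ := by
      rw [hI, Ideal.span_singleton_le_iff_mem, RingHom.mem_ker]
      simp only [Ψ, map_add, map_mul, aeval_X]
      simp
      linear_combination habc
    exact this hx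
  let A : MvPolynomial (Fin 3) ℂ := X 1 + X 2
  let B : MvPolynomial (Fin 3) ℂ := - X 2
  let C : MvPolynomial (Fin 3) ℂ := X 0 + X 2
  have ΨA : Ψ A = a := by simp [Ψ, A]
  have ΨB : Ψ B = b := by simp [Ψ, B]
  have ΨC : Ψ C = c := by simp [Ψ, C]
  have Ψnf : ∀ k j, Ψ (nf A B C k j) = nf a b c k j := by
    intro k j
    have := nf_map (Ψ : MvPolynomial (Fin 3) ℂ →+* R) A B C k j
    simp only [RingHom.coe_coe, ΨA, ΨB, ΨC] at this
    exact this
  let mk := Ideal.Quotient.mkₐ ℂ I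
  have hABC : mk A * mk C = mk B ^ 2 := by
    rw [← map_mul, ← map_pow, ← sub_eq_zero, ← map_sub]
    change Ideal.Quotient.mk I _ = 0
    rw [Ideal.Quotient.eq_zero_iff_mem]
    apply Ideal.subset_span
    simp only [Set.mem_singleton_iff, A, B, C]; ring
  let ψ0 : (MvPolynomial (Fin 3) ℂ ⧸ I) →ₐ[ℂ] R := Ideal.Quotient.liftₐ I Ψ hΨ
  have ψ0mk : ∀ x, ψ0 (Ideal.Quotient.mk I x) = Ψ x := fun x => rfl
  have mknf : ∀ k j, mk (nf A B C k j) = nf (mk A) (mk B) (mk C) k j := fun k j =>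
    nf_map (Ideal.Quotient.mk I) A B C k j
  have span_top : Submodule.span ℂ
      (Set.range (fun p : NFI => nf (mk A) (mk B) (mk C) p.1.1 p.1.2)) = ⊤ := by
    set N := Submodule.span ℂ
      (Set.range (fun p : NFI => nf (mk A) (mk B) (mk C) p.1.1 p.1.2)) with hN
    have memN : ∀ k j, j ≤ 2 * k → nf (mk A) (mk B) (mk C) k j ∈ N := fun k j h =>
      Submodule.subset_span ⟨⟨(k, j), h⟩, rfl⟩
    have stab : ∀ y, (∀ k j, j ≤ 2 * k → y * nf (mk A) (mk B) (mk C) k j ∈ N) →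
        ∀ x ∈ N, y * x ∈ N := by
      intro y hy x hx
      have : N ≤ N.comap (LinearMap.mulLeft ℂ y) := by
        conv_lhs => rw [hN]
        rw [Submodule.span_le]
        rintro _ ⟨⟨⟨k, j⟩, hj⟩, rfl⟩
        exact hy k j hj
      exact this hx
    have sA := stab (mk A) fun k j hj => by rw [nf_a hABC hj]; exact memN _ _ (by omega)
    have sB := stab (mk B) fun k j hj => by rw [nf_b hj]; exact memN _ _ (by omega)
    have sC := stab (mk C) fun k j hj => by rw [nf_c hABC hj]; exact memN _ _ (by omega)
    have sX : ∀ i, ∀ x ∈ N, mk (X i) * x ∈ N := by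
      intro i x hx
      fin_cases i
      · have : (X 0 : MvPolynomial (Fin 3) ℂ) = C + B := by simp [C, B]
        simp only [Fin.zero_eta]
        rw [this, map_add, add_mul]
        exact add_mem (sC x hx) (sB x hx)
      · have : (X 1 : MvPolynomial (Fin 3) ℂ) = A + B := by simp [A, B]
        simp only [Fin.mk_one]
        rw [this, map_add, add_mul]
        exact add_mem (sA x hx) (sB x hx)
      · have : (X 2 : MvPolynomial (Fin 3) ℂ) = (-1 : ℂ) • B := by simp [B]
        simp only [Fin.reduceFinMk]
        rw [this, map_smul, smul_mul_assoc]
        exact Submodule.smul_mem _ _ (sB x hx)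
    have oneN : (1 : MvPolynomial (Fin 3) ℂ ⧸ I) ∈ N := by
      have := memN 0 0 le_rfl
      simpa [nf] using this
    rw [eq_top_iff]
    rintro x -
    obtain ⟨f, rfl⟩ := Ideal.Quotient.mk_surjective x
    change mk f ∈ N
    induction f using MvPolynomial.induction_on with
    | C z =>
      rw [show (MvPolynomial.C z : MvPolynomial (Fin 3) ℂ) = z • 1 by
        rw [MvPolynomial.smul_eq_C_mul, mul_one], map_smul, map_one]
      exact Submodule.smul_mem _ _ oneN
    | add p q hp hq => rw [map_add]; exact add_mem hp hq
    | mul_X p i hp => rw [map_mul, mul_comm]; exact sX i _ hp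
  have inj : Function.Injective ψ0 := by
    rw [injective_iff_map_eq_zero]
    intro x hx
    have hx' : x ∈ Submodule.span ℂ
      (Set.range (fun p : NFI => nf (mk A) (mk B) (mk C) p.1.1 p.1.2)) := by
      rw [span_top]; trivial
    rw [Finsupp.mem_span_range_iff_exists_finsupp] at hx'
    obtain ⟨l, rfl⟩ := hx'
    have h2 : Finsupp.linearCombination ℂ (fun p : NFI => nf a b c p.1.1 p.1.2) l = 0 := by
      rw [← hx, Finsupp.linearCombination_apply, Finsupp.sum, Finsupp.sum, map_sum]
      refine Finset.sum_congr rfl fun p _ => ?_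
      rw [map_smul, ← mknf, ← Ψnf]
      rfl
    have := (linearIndependent_iff.mp li) l h2
    simp [this]
  have hsurj : ∀ (k : ℕ), ∀ g ∈ 𝒜 k,
        ∃ f : MvPolynomial (Fin 3) ℂ, f.IsHomogeneous k ∧ Ψ f = g := by
    intro k g hg
    have hAB : ∀ j, j ≤ 2 * k → (nf A B C k j) ∈ homogeneousSubmodule (Fin 3) ℂ k := by
      intro j hj
      refine nf_mem (fun k => homogeneousSubmodule (Fin 3) ℂ k) ?_ ?_ ?_ ?_ ?_ hj
      · exact isHomogeneous_one _ _
      · intro m n x y hx hy; exact IsHomogeneous.mul hx hy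
      · exact (isHomogeneous_X _ _).add (isHomogeneous_X _ _)
      · exact Submodule.neg_mem _ (isHomogeneous_X _ _)
      · exact (isHomogeneous_X _ _).add (isHomogeneous_X _ _)
    have h1 : (⟨g, hg⟩ : 𝒜 k) ∈ Submodule.span ℂ
      (Set.range (fun j : Fin (2 * k + 1) =>
        (⟨nf a b c k j, mem_nf k j (by omega)⟩ : 𝒜 k))) := by rw [spk k]; trivial
    have h2 : Submodule.span ℂ
      (Set.range (fun j : Fin (2 * k + 1) =>
        (⟨nf a b c k j, mem_nf k j (by omega)⟩ : 𝒜 k))) ≤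
        ((homogeneousSubmodule (Fin 3) ℂ k).map Ψ.toLinearMap).comap (𝒜 k).subtype := by
      rw [Submodule.span_le]
      rintro _ ⟨j, rfl⟩
      exact ⟨nf A B C k j, hAB j (by omega), Ψnf k j⟩
    obtain ⟨f, hf, hf'⟩ := h2 h1
    exact ⟨f, hf, hf'⟩
  have surj : Function.Surjective ψ0 := by
    intro y
    have : (⊤ : Submodule ℂ R) ≤ LinearMap.range ψ0.toLinearMap := by
      rw [← htop, iSup_le_iff]
      intro k g hg
      obtain ⟨f, -, hf⟩ := hsurj k g hg
      exact ⟨Ideal.Quotient.mk I f, hf⟩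
    exact this (Submodule.mem_top (x := y))
  refine ⟨⟨AlgEquiv.ofBijective ψ0 ⟨inj, surj⟩, ?_, ?_⟩, frk⟩
  · intro k f hf
    change Ψ f ∈ 𝒜 k
    have hX : ∀ i, Ψ (X i) ∈ 𝒜 1 := by
      intro i
      fin_cases i
      · simpa [Ψ] using add_mem hb hc
      · simpa [Ψ] using add_mem ha hb
      · simpa [Ψ] using hb
    rw [f.as_sum, map_sum]
    refine Submodule.sum_mem _ fun d hd => ?_
    have hdk : d.degree = k := by
      have := hf (mem_support_iff.mp hd)
      rw [Finsupp.degree_eq_weight_one]; exact this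
    rw [monomial_eq, map_mul, ← MvPolynomial.algebraMap_eq, AlgHom.commutes, ← Algebra.smul_def]
    refine Submodule.smul_mem _ _ ?_
    rw [Finsupp.prod_fintype _ _ (by simp), map_prod]
    rw [Finsupp.degree_eq_sum] at hdk
    rw [← hdk, Fin.sum_univ_three, Fin.prod_univ_three]
    have hp : ∀ x ∈ 𝒜 1, ∀ n, x ^ n ∈ 𝒜 n := by
      intro x hx n
      induction n with
      | zero => simpa using hone
      | succ n ih => rw [pow_succ]; exact hmul _ _ _ _ ih hx
    simp only [map_pow]
    exact hmul _ _ _ _ (hmul _ _ _ _ (hp _ (hX 0) _) (hp _ (hX 1) _)) (hp _ (hX 2) _)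
  · intro k g hg
    exact hsurj k g hg

abbrev G7 : Subgroup (GL (Fin 2) ℝ) := (CongruenceSubgroup.Gamma1 7 : Subgroup (GL (Fin 2) ℝ))

lemma one_mem_periods : (1 : ℝ) ∈ G7.strictPeriods := by
  rw [CongruenceSubgroup.strictPeriods_Gamma1]; exact AddSubgroup.mem_zmultiples 1

section Sturm
open UpperHalfPlane Filter Asymptotics ModularForm Topology
open scoped MatrixGroups ModularForm

lemma gamma1_mem_of_row {A B : SL(2, ℤ)} (h0 : ((A 1 0 : ℤ) : ZMod 7) = (B 1 0 : ℤ))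
    (h1 : ((A 1 1 : ℤ) : ZMod 7) = (B 1 1 : ℤ)) : A * B⁻¹ ∈ CongruenceSubgroup.Gamma1 7 := by
  have hA : (A 0 0 * A 1 1 - A 0 1 * A 1 0 : ℤ) = 1 := by
    have := A.det_coe; rwa [Matrix.det_fin_two] at this
  have hB : (B 0 0 * B 1 1 - B 0 1 * B 1 0 : ℤ) = 1 := by
    have := B.det_coe; rwa [Matrix.det_fin_two] at this
  have hA' := congrArg (Int.cast : ℤ → ZMod 7) hA
  have hB' := congrArg (Int.cast : ℤ → ZMod 7) hB
  push_cast at hA' hB'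
  rw [CongruenceSubgroup.Gamma1_mem]
  simp only [Matrix.SpecialLinearGroup.coe_mul, Matrix.SpecialLinearGroup.coe_inv,
    Matrix.adjugate_fin_two, Matrix.mul_apply, Fin.sum_univ_two]
  simp
  rw [h0, h1] at hA' ⊢
  refine ⟨?_, ?_, ?_⟩
  · linear_combination hA'
  · linear_combination hB'
  · ring

lemma index_le : (CongruenceSubgroup.Gamma1 7).index ≤ 48 := by
  have h48 : Nat.card {v : ZMod 7 × ZMod 7 // v ≠ 0} = 48 := by
    rw [Nat.card_eq_fintype_card]; decide
  rw [← h48]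
  refine Nat.card_le_card_of_injective (fun q : SL(2, ℤ) ⧸ CongruenceSubgroup.Gamma1 7 =>
    (⟨((((q.out⁻¹ : SL(2, ℤ)) 1 0 : ℤ) : ZMod 7), (((q.out⁻¹ : SL(2, ℤ)) 1 1 : ℤ) : ZMod 7)), ?_⟩ :
      {v : ZMod 7 × ZMod 7 // v ≠ 0})) ?_
  · intro h
    set A := q.out⁻¹
    have hA : (A 0 0 * A 1 1 - A 0 1 * A 1 0 : ℤ) = 1 := by
      have := A.det_coe; rwa [Matrix.det_fin_two] at this
    have hA' := congrArg (Int.cast : ℤ → ZMod 7) hA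
    push_cast at hA'
    rw [Prod.ext_iff] at h
    simp only [Prod.fst_zero, Prod.snd_zero] at h
    rw [h.1, h.2] at hA'
    simp only [mul_zero, sub_zero] at hA'
    exact absurd hA' (by decide)
  · intro q q' h
    simp only [Subtype.mk.injEq, Prod.mk.injEq] at h
    rw [← q.out_eq', ← q'.out_eq']
    rw [QuotientGroup.eq]
    simpa using gamma1_mem_of_row h.1 h.2

lemma card_quot_le : Nat.card (𝒮ℒ ⧸ (G7.subgroupOf 𝒮ℒ)) ≤ 48 := by
  have : Nat.card (𝒮ℒ ⧸ (G7.subgroupOf 𝒮ℒ)) = (CongruenceSubgroup.Gamma1 7).index := by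
    change G7.relIndex 𝒮ℒ = _
    rw [← Subgroup.relIndex_top_right]
    rw [MonoidHom.range_eq_map]
    exact Subgroup.relIndex_map_map_of_injective _ _ Matrix.SpecialLinearGroup.mapGL_injective
  rw [this]; exact index_le

/-- decay of a form with vanishing low coefficients -/
lemma decay_of_coeff (k : ℤ) (f : ModularForm G7 k) (m : ℕ)
    (h : ∀ i < m, (qExpansion 1 f).coeff i = 0) :
    (f : ℍ → ℂ) =O[atImInfty] fun τ => Real.exp (-2 * Real.pi * τ.im) ^ m := by
  have han := ModularFormClass.analyticAt_cuspFunction_zero f one_pos one_mem_periods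
  have hps := (UpperHalfPlane.hasFPowerSeries_cuspFunction f (c := fun m => (qExpansion 1 f).coeff m)
    one_pos han (fun τ => by
      simpa using ModularForm.hasSum_qExpansion f one_pos one_mem_periods τ)).hasFPowerSeriesAt
  have h1 := hps.isBigO_sub_partialSum_pow m
  have hq : Tendsto (fun τ : ℍ => Function.Periodic.qParam 1 τ) atImInfty (𝓝 0) :=
    qParam_tendsto_atImInfty one_pos
  have h2 := h1.comp_tendsto hq
  refine (h2.congr' ?_ ?_)
  · filter_upwards with τ
    simp only [Function.comp_apply, zero_add]
    rw [SlashInvariantFormClass.eq_cuspFunction f τ one_mem_periods one_ne_zero]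
    rw [FormalMultilinearSeries.partialSum, Finset.sum_eq_zero, sub_zero]
    intro i hi
    rw [Finset.mem_range] at hi
    rw [FormalMultilinearSeries.apply_eq_pow_smul_coeff, qExpansionFormalMultilinearSeries_coeff,
      h i hi, smul_zero]
  · filter_upwards with τ
    simp [Function.Periodic.norm_qParam]

lemma coeff_of_decay (k : ℤ) (f : ModularForm 𝒮ℒ k) (m : ℕ)
    (h : (f : ℍ → ℂ) =O[atImInfty] fun τ => Real.exp (-2 * Real.pi * τ.im) ^ m) (n : ℕ)
    (hn : n < m) : (qExpansion 1 f).coeff n = 0 := by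
  have h1p : (1 : ℝ) ∈ (𝒮ℒ : Subgroup (GL (Fin 2) ℝ)).strictPeriods := by simp
  obtain ⟨C, hC⟩ := h.bound
  rw [Filter.Eventually, atImInfty_mem] at hC
  obtain ⟨A, hA⟩ := hC
  have key : ∀ t : ℝ, max A 1 ≤ t → ‖(qExpansion 1 f).coeff n‖ ≤ C * Real.exp (-2 * Real.pi * t) := by
    intro t ht
    have ht0 : 0 < t := lt_of_lt_of_le one_pos ((le_max_right _ _).trans ht)
    rw [ModularFormClass.qExpansion_coeff_eq_intervalIntegral f one_pos h1p n ht0]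
    rw [norm_mul]
    simp only [Complex.ofReal_one, div_one, norm_one, one_mul]
    refine (intervalIntegral.norm_integral_le_of_norm_le_const
      (C := C * Real.exp (-2 * Real.pi * t)) ?_).trans (by simp)
    intro u _
    have e1 := hA ⟨u + t * Complex.I, by simpa using ht0⟩ (by
      have : (UpperHalfPlane.mk (u + t * Complex.I) (by simpa using ht0)).im = t := by
        simp [UpperHalfPlane.im]
      rw [this]; exact (le_max_left _ _).trans ht)
    have him : (UpperHalfPlane.mk (u + t * Complex.I) (by simpa using ht0)).im = t := by
      simp [UpperHalfPlane.im]
    simp only [Set.mem_ofPred_eq, him] at e1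
    rw [norm_mul, norm_div, norm_pow, Function.Periodic.norm_qParam]
    have e2 : (u + t * Complex.I : ℂ).im = t := by simp
    rw [e2, norm_one, div_one]
    set E := Real.exp (-2 * Real.pi * t) with hE
    have hE0 : 0 < E := Real.exp_pos _
    have hE1 : E ≤ 1 := by
      rw [hE, Real.exp_le_one_iff]; nlinarith [Real.pi_pos]
    have hC0 : 0 ≤ C := by
      by_contra hneg
      have := (norm_nonneg _).trans e1
      have : 0 < ‖E ^ m‖ := norm_pos_iff.mpr (pow_ne_zero _ hE0.ne')
      nlinarith
    rw [Real.norm_of_nonneg (by positivity)] at e1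
    calc 1 / E ^ n * _ ≤ 1 / E ^ n * (C * E ^ m) := by gcongr
      _ = C * E ^ (m - n) := by
        rw [show E ^ m = E ^ n * E ^ (m - n) by rw [← pow_add]; congr 1; omega]
        field_simp
      _ ≤ C * E ^ 1 := by
        gcongr ?_ * ?_
        exact pow_le_pow_of_le_one hE0.le hE1 (by omega)
      _ = C * E := by rw [pow_one]
  have hlim : Tendsto (fun t : ℝ => C * Real.exp (-2 * Real.pi * t)) atTop (𝓝 (C * 0)) := by
    refine Tendsto.const_mul _ (Real.tendsto_exp_atBot.comp ?_)
    exact tendsto_id.const_mul_atTop_of_neg (by nlinarith [Real.pi_pos])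
  rw [mul_zero] at hlim
  have := ge_of_tendsto hlim ((eventually_ge_atTop (max A 1)).mono key)
  exact norm_le_zero_iff.mp this

lemma sturm7 (k : ℕ) (f : ModularForm G7 (k : ℤ))
    (h : ∀ i ≤ 2 * k, (UpperHalfPlane.qExpansion 1 f).coeff i = 0) : f = 0 := by
  classical
  suffices hN : ModularForm.norm 𝒮ℒ f = 0 by
    rw [ModularForm.norm_eq_zero_iff] at hN
    exact DFunLike.coe_injective hN
  let : Fintype (𝒮ℒ ⧸ (G7.subgroupOf 𝒮ℒ)) := Fintype.ofFinite _
  have hdec := decay_of_coeff k f (2 * k + 1) (fun i hi => h i (by omega))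
  have hbdd : ∀ q : 𝒮ℒ ⧸ (G7.subgroupOf 𝒮ℒ),
      (SlashInvariantForm.quotientFunc f q) =O[atImInfty] (1 : ℍ → ℝ) := by
    intro q
    induction q using Quotient.inductionOn with
    | h r =>
      rw [SlashInvariantForm.quotientFunc_mk]
      obtain ⟨_, ⟨s, rfl⟩⟩ := r
      have := ModularFormClass.bdd_at_infty_slash f s⁻¹
      simpa [SL_slash, Matrix.SpecialLinearGroup.mapGL, IsBoundedAtImInfty, BoundedAtFilter] using this
  let mone : 𝒮ℒ := ⟨Matrix.SpecialLinearGroup.mapGL ℝ (-1 : SL(2, ℤ)), ⟨-1, rfl⟩⟩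
  let q1 : 𝒮ℒ ⧸ (G7.subgroupOf 𝒮ℒ) := ⟦1⟧
  let q2 : 𝒮ℒ ⧸ (G7.subgroupOf 𝒮ℒ) := ⟦mone⟧
  have hq12 : q1 ≠ q2 := by
    intro he
    have h1 := QuotientGroup.eq.mp he
    rw [inv_one, one_mul, Subgroup.mem_subgroupOf] at h1
    obtain ⟨g, hg, hg'⟩ := h1
    obtain rfl : g = -1 := Matrix.SpecialLinearGroup.mapGL_injective hg'
    have h2 := ((CongruenceSubgroup.Gamma1_mem _ _).mp hg).1
    simp at h2
    exact absurd h2 (by decide)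
  have hd1 : (SlashInvariantForm.quotientFunc f q1) =O[atImInfty]
      fun τ => Real.exp (-2 * Real.pi * τ.im) ^ (2 * k + 1) := by
    simp only [q1]
    rw [SlashInvariantForm.quotientFunc_mk]
    simpa using hdec
  have hd2 : (SlashInvariantForm.quotientFunc f q2) =O[atImInfty]
      fun τ => Real.exp (-2 * Real.pi * τ.im) ^ (2 * k + 1) := by
    simp only [q2]
    rw [SlashInvariantForm.quotientFunc_mk]
    refine IsBigO.trans (IsBigO.of_bound 1 (Eventually.of_forall fun τ => ?_)) hdec
    have e : (mone.val)⁻¹ = ((-1 : SL(2, ℤ)) : GL (Fin 2) ℝ) := by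
      change (Matrix.SpecialLinearGroup.mapGL ℝ (-1 : SL(2, ℤ)))⁻¹ = Matrix.SpecialLinearGroup.mapGL ℝ (-1)
      rw [← map_inv, inv_neg, inv_one]
    rw [e, ← SL_slash, SL_slash_apply]
    rw [ModularGroup.SL_neg_smul, one_smul]
    simp [denom]
  have hN : (ModularForm.norm 𝒮ℒ f : ℍ → ℂ) =O[atImInfty]
      fun τ => Real.exp (-2 * Real.pi * τ.im) ^ (4 * k + 2) := by
    rw [ModularForm.coe_norm]
    rw [← Finset.mul_prod_erase Finset.univ _ (Finset.mem_univ q1),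
      ← Finset.mul_prod_erase (Finset.univ.erase q1) _ (Finset.mem_erase.mpr ⟨hq12.symm, Finset.mem_univ q2⟩)]
    have hr : (∏ q ∈ (Finset.univ.erase q1).erase q2, SlashInvariantForm.quotientFunc f q)
        =O[atImInfty] (1 : ℍ → ℝ) := by
      rw [show (1 : ℍ → ℝ) = (fun x ↦ ∏ i ∈ (Finset.univ.erase q1).erase q2, 1) by ext; simp,
        Finset.prod_fn]
      exact .finsetProd fun q _ => hbdd q
    refine (hd1.mul (hd2.mul hr)).congr (fun _ => rfl) (fun τ => ?_)
    simp only [Pi.one_apply]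
    ring
  apply ModularForm.sturm_bound_levelOne
  refine lt_of_lt_of_le (b := ((4 * k + 2 : ℕ) : ℕ∞)) ?_ ?_
  · rw [Nat.cast_lt]
    have hc := card_quot_le
    have : ((k : ℤ) * (Nat.card (𝒮ℒ ⧸ (G7.subgroupOf 𝒮ℒ)) : ℤ)).toNat
        = k * Nat.card (𝒮ℒ ⧸ (G7.subgroupOf 𝒮ℒ)) := by
      rw [← Nat.cast_mul, Int.toNat_natCast]
    rw [this]
    have : k * Nat.card (𝒮ℒ ⧸ (G7.subgroupOf 𝒮ℒ)) ≤ k * 48 := Nat.mul_le_mul_left _ hc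
    omega
  · refine PowerSeries.nat_le_order _ _ fun i hi => ?_
    exact coeff_of_decay _ _ _ hN i hi

end Sturm

section Eis
open UpperHalfPlane EisensteinSeries Filter Topology Complex MatrixGroups ModularForm

/-- The linear form attached to an integer vector. -/
noncomputable def ev (w : Fin 2 → ℤ) (τ : ℍ) : ℂ := (w 0 : ℂ) * τ + w 1

lemma ev_add (v w : Fin 2 → ℤ) (τ : ℍ) : ev (v + w) τ = ev v τ + ev w τ := by
  simp [ev]; ring

lemma ev_smul (a : ℤ) (w : Fin 2 → ℤ) (τ : ℍ) : ev (a • w) τ = a * ev w τ := by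
  simp [ev]; ring

lemma ev_neg (w : Fin 2 → ℤ) (τ : ℍ) : ev (-w) τ = - ev w τ := by
  simp [ev]; ring

lemma ev_ne {w : Fin 2 → ℤ} (hw : w ≠ 0) (τ : ℍ) : ev w τ ≠ 0 := by
  have h := r_mul_max_le τ hw
  have : 0 < r τ * ‖w‖ := mul_pos (r_pos τ) (norm_pos_iff.mpr hw)
  exact norm_pos_iff.mp (this.trans_le h)

/-- Vectors that do not vanish modulo 7. -/
def Good (v : Fin 2 → ℤ) : Prop := ¬ ((7 : ℤ) ∣ v 0 ∧ (7 : ℤ) ∣ v 1)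

lemma Good.ne {v : Fin 2 → ℤ} (hv : Good v) (l : Fin 2 → ℤ) (j : ℤ) (hj : j = 1 ∨ j = 2 ∨ j = 3) :
    (7 : ℤ) • l + j • v ≠ 0 := by
  intro h
  apply hv
  have h0 := congrFun h 0
  have h1 := congrFun h 1
  simp at h0 h1
  rcases hj with rfl | rfl | rfl <;> constructor <;> omega

/-- The summand. -/
noncomputable def T (v l : Fin 2 → ℤ) (τ : ℍ) : ℂ :=
  ev v τ ^ 2 / (ev ((7 : ℤ) • l + (1 : ℤ) • v) τ * ev ((7 : ℤ) • l + (2 : ℤ) • v) τ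
    * ev ((7 : ℤ) • l + (3 : ℤ) • v) τ)

/-- The series. -/
noncomputable def F (v : Fin 2 → ℤ) (τ : ℍ) : ℂ := ∑' l : Fin 2 → ℤ, T v l τ

/-- The bounding summand. -/
noncomputable def bd (v l : Fin 2 → ℤ) : ℝ :=
  (‖(7 : ℤ) • l + (1 : ℤ) • v‖⁻¹) ^ 3 + (‖(7 : ℤ) • l + (2 : ℤ) • v‖⁻¹) ^ 3
    + (‖(7 : ℤ) • l + (3 : ℤ) • v‖⁻¹) ^ 3

lemma bd_nonneg (v l) : 0 ≤ bd v l := by unfold bd; positivity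

lemma summable_bd (v) : Summable (bd v) := by
  have h0 : Summable fun x : Fin 2 → ℤ => (‖x‖⁻¹) ^ 3 := by
    refine (summable_one_div_norm_rpow (k := 3) (by norm_num)).congr fun x => ?_
    rw [Real.rpow_neg (norm_nonneg _), inv_pow]
    norm_cast
  have hinj : ∀ j : ℤ, Function.Injective fun l : Fin 2 → ℤ => (7 : ℤ) • l + j • v := by
    intro j a b h
    ext i
    have := congrFun h i
    simp at this
    exact this
  exact ((h0.comp_injective (hinj 1)).add (h0.comp_injective (hinj 2))).add
    (h0.comp_injective (hinj 3))

lemma amgm (x y z : ℝ) (hx : 0 ≤ x) (hy : 0 ≤ y) (hz : 0 ≤ z) : x * y * z ≤ x ^ 3 + y ^ 3 + z ^ 3 := by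
  have : 0 ≤ (x + y + z) * ((x - y) ^ 2 + (y - z) ^ 2 + (x - z) ^ 2) := by positivity
  nlinarith [pow_nonneg hx 3, pow_nonneg hy 3, pow_nonneg hz 3, mul_nonneg (mul_nonneg hx hy) hz]

lemma T_bound {v : Fin 2 → ℤ} (hv : Good v) (l : Fin 2 → ℤ) (τ : ℍ) {ρ : ℝ} (hρ : 0 < ρ)
    (h : ρ ≤ r τ) : ‖T v l τ‖ ≤ ‖ev v τ‖ ^ 2 * (ρ⁻¹) ^ 3 * bd v l := by
  have key : ∀ j : ℤ, (j = 1 ∨ j = 2 ∨ j = 3) → ‖ev ((7 : ℤ) • l + j • v) τ‖⁻¹ ≤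
      ρ⁻¹ * ‖(7 : ℤ) • l + j • v‖⁻¹ := by
    intro j hj
    have hne := hv.ne l j hj
    have hpos := norm_pos_iff.mpr hne
    rw [← mul_inv]
    apply inv_anti₀ (by positivity)
    exact (mul_le_mul_of_nonneg_right h hpos.le).trans (r_mul_max_le τ hne)
  have k1 := key 1 (by simp)
  have k2 := key 2 (by simp)
  have k3 := key 3 (by simp)
  have ag := amgm _ _ _ (inv_nonneg.mpr (norm_nonneg ((7 : ℤ) • l + (1 : ℤ) • v)))
    (inv_nonneg.mpr (norm_nonneg ((7 : ℤ) • l + (2 : ℤ) • v)))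
    (inv_nonneg.mpr (norm_nonneg ((7 : ℤ) • l + (3 : ℤ) • v)))
  unfold T
  rw [norm_div, norm_pow, norm_mul, norm_mul, div_eq_mul_inv, mul_inv, mul_inv, mul_assoc (‖ev v τ‖ ^ 2) _ (bd v l)]
  apply mul_le_mul_of_nonneg_left _ (by positivity)
  calc _ ≤ (ρ⁻¹ * ‖(7 : ℤ) • l + (1 : ℤ) • v‖⁻¹) * (ρ⁻¹ * ‖(7 : ℤ) • l + (2 : ℤ) • v‖⁻¹)
        * (ρ⁻¹ * ‖(7 : ℤ) • l + (3 : ℤ) • v‖⁻¹) := by gcongr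
    _ = (ρ⁻¹) ^ 3 * (‖(7 : ℤ) • l + (1 : ℤ) • v‖⁻¹ * ‖(7 : ℤ) • l + (2 : ℤ) • v‖⁻¹
        * ‖(7 : ℤ) • l + (3 : ℤ) • v‖⁻¹) := by ring
    _ ≤ _ := mul_le_mul_of_nonneg_left ag (by positivity)

lemma summable_T {v : Fin 2 → ℤ} (hv : Good v) (τ : ℍ) : Summable fun l => T v l τ :=
  Summable.of_norm_bounded ((summable_bd v).mul_left _)
    fun l => T_bound hv l τ (r_pos τ) le_rfl

lemma F_bound {v : Fin 2 → ℤ} (hv : Good v) (τ : ℍ) {ρ : ℝ} (hρ : 0 < ρ)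
    (h : ρ ≤ r τ) : ‖F v τ‖ ≤ ‖ev v τ‖ ^ 2 * (ρ⁻¹) ^ 3 * ∑' l, bd v l := by
  rw [← tsum_mul_left]
  exact tsum_of_norm_bounded ((summable_bd v).mul_left _).hasSum fun l => T_bound hv l τ hρ h

open scoped Manifold in
lemma F_mdiff {v : Fin 2 → ℤ} (hv : Good v) : MDiff (F v) := by
  rw [UpperHalfPlane.mdifferentiable_iff]
  set ex : (Fin 2 → ℤ) → ℂ → ℂ := fun w z => (w 0 : ℂ) * z + w 1 with hex
  set Tx : (Fin 2 → ℤ) → ℂ → ℂ := fun l z => ex v z ^ 2 / (ex ((7 : ℤ) • l + (1 : ℤ) • v) z *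
    ex ((7 : ℤ) • l + (2 : ℤ) • v) z * ex ((7 : ℤ) • l + (3 : ℤ) • v) z) with hTx
  have hTT : ∀ l (τ : ℍ), Tx l τ = T v l τ := fun l τ => rfl
  have hU : IsOpen {z : ℂ | 0 < z.im} := isOpen_upperHalfPlaneSet
  have hdT : ∀ l, DifferentiableOn ℂ (Tx l) {z : ℂ | 0 < z.im} := by
    intro l
    apply DifferentiableOn.div
    · fun_prop
    · fun_prop
    · intro z hz
      have h1 := ev_ne (hv.ne l 1 (by simp)) ⟨z, hz⟩
      have h2 := ev_ne (hv.ne l 2 (by simp)) ⟨z, hz⟩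
      have h3 := ev_ne (hv.ne l 3 (by simp)) ⟨z, hz⟩
      exact mul_ne_zero (mul_ne_zero h1 h2) h3
  have hloc : TendstoLocallyUniformlyOn (fun (s : Finset (Fin 2 → ℤ)) z => ∑ l ∈ s, Tx l z)
      (fun z => ∑' l, Tx l z) atTop {z : ℂ | 0 < z.im} := by
    rw [tendstoLocallyUniformlyOn_iff_forall_isCompact hU]
    intro K hKU hK
    have hK' : IsCompact ((↑) ⁻¹' K : Set ℍ) := by
      refine UpperHalfPlane.isOpenEmbedding_coe.isInducing.isCompact_preimage_iff ?_ |>.mpr hK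
      intro z hz
      exact ⟨⟨z, hKU hz⟩, rfl⟩
    obtain ⟨A, B, hB, hAB⟩ := subset_verticalStrip_of_isCompact hK'
    obtain ⟨M, hM⟩ := hK.exists_bound_of_continuousOn (f := ex v) (by fun_prop)
    apply tendstoUniformlyOn_tsum
      (hu := (summable_bd v).mul_left (M ^ 2 * ((r ⟨⟨A, B⟩, hB⟩)⁻¹) ^ 3))
    intro l z hz
    have := T_bound hv l ⟨z, hKU hz⟩ (r_pos _) (r_lower_bound_on_verticalStrip ⟨z, hKU hz⟩ hB (hAB hz))
    refine this.trans ?_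
    have h0 := bd_nonneg v l
    have hr := r_pos ⟨⟨A, B⟩, hB⟩
    have := hM z hz
    have h5 : ‖ev v ⟨z, hKU hz⟩‖ ≤ M := this
    gcongr
  have := hloc.differentiableOn (Eventually.of_forall fun s => DifferentiableOn.fun_sum fun l _ => hdT l) hU
  refine this.congr fun z hz => ?_
  lift z to ℍ using hz
  simp only [Function.comp_apply, ofComplex_apply]
  rfl

lemma ev_smul_SL (γ : SL(2, ℤ)) (w : Fin 2 → ℤ) (τ : ℍ) :
    ev w (γ • τ) = ev (Matrix.vecMul w γ.1) τ / denom γ τ := by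
  have hd : denom γ τ ≠ 0 := denom_ne_zero γ τ
  rw [eq_div_iff hd]
  have h (a b c d u v t : ℂ) (hc : c * t + d ≠ 0) : (u * ((a * t + b) / (c * t + d)) + v) * (c * t + d)
      = (u * a + v * c) * t + (u * b + v * d) := by
    rw [add_mul, mul_assoc, div_mul_cancel₀ _ hc]; ring
  simp only [ev, denom, UpperHalfPlane.specialLinearGroup_apply, Matrix.vecMul, Matrix.vec2_dotProduct]
  simpa using h (hc := hd) ..

lemma F_slash (γ : SL(2, ℤ)) (v : Fin 2 → ℤ) : F v ∣[(1 : ℤ)] γ = F (Matrix.vecMul v γ.1) := by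
  ext1 τ
  have hd : denom γ τ ≠ 0 := denom_ne_zero γ τ
  rw [SL_slash_apply]
  have hT : ∀ l, T v l (γ • τ) * denom γ τ ^ (-1 : ℤ) =
      T (Matrix.vecMul v γ.1) (Matrix.vecMul l γ.1) τ := by
    intro l
    unfold T
    simp only [ev_smul_SL, Matrix.add_vecMul, Matrix.smul_vecMul]
    rw [zpow_neg_one]
    have h2 : ∀ a b c d D : ℂ, D ≠ 0 → (a / D) ^ 2 / (b / D * (c / D) * (d / D)) * D⁻¹ =
        a ^ 2 / (b * c * d) := by
      intro a b c d D hD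
      by_cases hb : b = 0
      · simp [hb]
      by_cases hc : c = 0
      · simp [hc]
      by_cases hd : d = 0
      · simp [hd]
      field_simp
    exact h2 _ _ _ _ _ hd
  unfold F
  rw [← tsum_mul_right]
  simp_rw [hT]
  let E : (Fin 2 → ℤ) ≃ (Fin 2 → ℤ) :=
    { toFun := fun l => Matrix.vecMul l γ.1
      invFun := fun l => Matrix.vecMul l (γ⁻¹).1
      left_inv := fun l => by
        simp only [Matrix.vecMul_vecMul]
        rw [← Matrix.SpecialLinearGroup.coe_mul, mul_inv_cancel]; simp
      right_inv := fun l => by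
        simp only [Matrix.vecMul_vecMul]
        rw [← Matrix.SpecialLinearGroup.coe_mul, inv_mul_cancel]; simp }
  exact E.tsum_eq (fun l => T (Matrix.vecMul v γ.1) l τ)

lemma F_neg (v : Fin 2 → ℤ) (τ : ℍ) : F (-v) τ = - F v τ := by
  unfold F
  rw [← tsum_neg, ← (Equiv.neg (Fin 2 → ℤ)).tsum_eq]
  congr 1
  ext l
  have h : ∀ j : ℤ, (7 : ℤ) • (-l) + j • (-v) = -((7 : ℤ) • l + j • v) := by intro j; simp; ring
  simp only [Equiv.neg_apply, T, h, ev_neg]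
  rw [neg_sq, ← div_neg]
  congr 1
  ring

lemma Good.add {v : Fin 2 → ℤ} (hv : Good v) (u : Fin 2 → ℤ) : Good (v + (7 : ℤ) • u) := by
  intro h
  apply hv
  simpa [Good] using h

lemma Good.vecMul {v : Fin 2 → ℤ} (hv : Good v) (γ : SL(2, ℤ)) : Good (Matrix.vecMul v γ.1) := by
  rintro ⟨⟨a, ha⟩, ⟨b, hb⟩⟩
  apply hv
  have h1 : Matrix.vecMul (Matrix.vecMul v γ.1) (γ⁻¹).1 = v := by
    simp only [Matrix.vecMul_vecMul]
    rw [← Matrix.SpecialLinearGroup.coe_mul, mul_inv_cancel]; simp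
  have h2 : Matrix.vecMul v γ.1 = (7 : ℤ) • ![a, b] := by
    ext i; fin_cases i <;> simp [ha, hb]
  rw [h2, Matrix.smul_vecMul] at h1
  rw [← h1]
  exact ⟨⟨_, rfl⟩, ⟨_, rfl⟩⟩

lemma summable_ev_line (w : Fin 2 → ℤ) (m : ℤ) (τ : ℍ) :
    Summable fun n : ℤ => (‖ev ((7 : ℤ) • ![m, n] + w) τ‖⁻¹) ^ 2 := by
  have h := (linear_right_summable (τ : ℂ) (7 * m + w 0) (k := 2) le_rfl).norm
  have hinj : Function.Injective fun n : ℤ => 7 * n + w 1 := by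
    intro a b h; simpa using h
  refine (h.comp_injective hinj).congr fun n => ?_
  simp [ev]

lemma pf (L X : ℂ) (h1 : L + 1 * X ≠ 0) (h2 : L + 2 * X ≠ 0) (h3 : L + 3 * X ≠ 0) :
    X ^ 2 / ((L + 1 * X) * (L + 2 * X) * (L + 3 * X)) =
      ((L + 1 * X)⁻¹ + (L + 3 * X)⁻¹ - 2 * (L + 2 * X)⁻¹) / 2 := by
  rw [one_mul] at h1 ⊢
  rw [mul_comm] at h2 h3
  rw [mul_comm 2 X, mul_comm 3 X]
  field_simp
  ring

lemma mul_le_sq_add (a b : ℝ) : a * b ≤ a ^ 2 + b ^ 2 := by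
  nlinarith [sq_nonneg (a - b), sq_nonneg a, sq_nonneg b]

set_option maxHeartbeats 1000000 in
lemma F_shift_right {v : Fin 2 → ℤ} (hv : Good v) (τ : ℍ) :
    F (v + (7 : ℤ) • ![0, 1]) τ = F v τ := by
  set e : Fin 2 → ℤ := ![0, 1] with he
  have hv' := hv.add e
  set v' := v + (7 : ℤ) • e with hv'def
  have hs' := summable_T hv' τ
  have hs := summable_T hv τ
  have hF' : F v' τ = ∑' l, T v' (l + (-2 : ℤ) • e) τ :=
    ((Equiv.addRight ((-2 : ℤ) • e)).tsum_eq (fun l => T v' l τ)).symm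
  have hs'' : Summable fun l => T v' (l + (-2 : ℤ) • e) τ :=
    (Equiv.addRight ((-2 : ℤ) • e)).summable_iff.mpr hs'
  set h : (Fin 2 → ℤ) → ℂ := fun l => (ev ((7 : ℤ) • l + (3 : ℤ) • v) τ)⁻¹
    - (ev ((7 : ℤ) • l + (v - (7 : ℤ) • e)) τ)⁻¹ with hh
  have key : ∀ l, T v' (l + (-2 : ℤ) • e) τ - T v l τ = (h (l + e) - h l) / 2 := by
    intro l
    have a1 := ev_ne (hv.ne l 1 (by simp)) τ
    have a2 := ev_ne (hv.ne l 2 (by simp)) τ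
    have a3 := ev_ne (hv.ne l 3 (by simp)) τ
    have b1 := ev_ne (hv'.ne (l + (-2 : ℤ) • e) 1 (by simp)) τ
    have b2 := ev_ne (hv'.ne (l + (-2 : ℤ) • e) 2 (by simp)) τ
    have b3 := ev_ne (hv'.ne (l + (-2 : ℤ) • e) 3 (by simp)) τ
    simp only [T, hh, hv'def, sub_eq_add_neg, ev_add, ev_neg, ev_smul] at a1 a2 a3 b1 b2 b3 ⊢
    generalize ev l τ = L at *
    generalize ev v τ = X at *
    generalize ev e τ = E at *
    push_cast at *
    rw [pf _ _ a1 a2 a3, pf _ _ b1 b2 b3]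
    ring_nf
  have hsub : F v' τ - F v τ = ∑' l, (T v' (l + (-2 : ℤ) • e) τ - T v l τ) := by
    rw [hF', F, hs''.tsum_sub hs]
  have hsD : Summable fun l => (T v' (l + (-2 : ℤ) • e) τ - T v l τ) := hs''.sub hs
  rw [← sub_eq_zero, hsub]
  rw [← (finTwoArrowEquiv ℤ).symm.tsum_eq]
  have hsP := (finTwoArrowEquiv ℤ).symm.summable_iff.mpr hsD
  refine (Summable.tsum_prod hsP).trans ?_
  have inner : ∀ m : ℤ, ∑' n : ℤ, (h (![m, n] + e) - h ![m, n]) / 2 = 0 := by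
    intro m
    have hsum : Summable fun n : ℤ => h ![m, n] := by
      have s1 := summable_ev_line ((3 : ℤ) • v) m τ
      have s2 := summable_ev_line (v - (7 : ℤ) • e) m τ
      refine Summable.of_norm_bounded ((s1.add s2).mul_left ‖ev ((2 : ℤ) • v + (7 : ℤ) • e) τ‖) fun n => ?_
      have a3 := ev_ne (hv.ne ![m, n] 3 (by simp)) τ
      have a1 := ev_ne (hv.ne (![m, n] - e) 1 (by simp)) τ
      have e1 : (7 : ℤ) • (![m, n] - e) + (1 : ℤ) • v = (7 : ℤ) • ![m, n] + (v - (7 : ℤ) • e) := by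
        simp only [smul_sub, one_smul]; abel
      rw [e1] at a1
      have e2 : ev ((2 : ℤ) • v + (7 : ℤ) • e) τ = ev ((7 : ℤ) • ![m, n] + (3 : ℤ) • v) τ -
          ev ((7 : ℤ) • ![m, n] + (v - (7 : ℤ) • e)) τ := by
        simp only [sub_eq_add_neg, ev_add, ev_neg, ev_smul]; push_cast; ring
      have e3 : h ![m, n] = - ev ((2 : ℤ) • v + (7 : ℤ) • e) τ *
          ((ev ((7 : ℤ) • ![m, n] + (3 : ℤ) • v) τ)⁻¹ *
          (ev ((7 : ℤ) • ![m, n] + (v - (7 : ℤ) • e)) τ)⁻¹) := by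
        simp only [hh]
        rw [e2]
        field_simp
        ring
      rw [e3, norm_mul, norm_neg, norm_mul, norm_inv, norm_inv]
      exact mul_le_mul_of_nonneg_left (mul_le_sq_add _ _) (norm_nonneg _)
    have hve : ∀ n : ℤ, ![m, n] + e = ![m, n + 1] := by
      intro n; ext i; fin_cases i <;> simp [he]
    simp_rw [hve]
    have hsum1 : Summable fun n : ℤ => h ![m, n + 1] :=
      (Equiv.addRight (1 : ℤ)).summable_iff.mpr hsum
    have heq : ∑' n : ℤ, h ![m, n + 1] = ∑' n : ℤ, h ![m, n] :=
      (Equiv.addRight (1 : ℤ)).tsum_eq (fun n : ℤ => h ![m, n])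
    rw [tsum_div_const, hsum1.tsum_sub hsum, heq, sub_self, zero_div]
  calc _ = ∑' m : ℤ, (0 : ℂ) := by
        congr 1
        ext m
        rw [← inner m]
        congr 1
        ext n
        rw [← key]
        rfl
    _ = 0 := tsum_zero

lemma F_shift_left {v : Fin 2 → ℤ} (hv : Good v) :
    F (v + (7 : ℤ) • ![1, 0]) = F v := by
  have h1 : F (v + (7 : ℤ) • ![1, 0]) ∣[(1 : ℤ)] ModularGroup.S = F v ∣[(1 : ℤ)] ModularGroup.S := by
    rw [F_slash, F_slash]
    have e1 : Matrix.vecMul (v + (7 : ℤ) • ![1, 0]) ModularGroup.S.1 + (7 : ℤ) • ![0, 1]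
        = Matrix.vecMul v ModularGroup.S.1 := by
      ext i; fin_cases i <;> simp [ModularGroup.S, Matrix.vecMul, dotProduct, Fin.sum_univ_two, Matrix.vecHead, Matrix.vecTail]
    rw [← e1]
    ext1 τ
    exact (F_shift_right ((hv.add _).vecMul _) τ).symm
  have h2 := congrArg (fun f => f ∣[(1 : ℤ)] (ModularGroup.S⁻¹ : SL(2, ℤ))) h1
  simpa only [← SlashAction.slash_mul, mul_inv_cancel, SlashAction.slash_one] using h2

lemma F_shift {v : Fin 2 → ℤ} (hv : Good v) (u : Fin 2 → ℤ) : F (v + (7 : ℤ) • u) = F v := by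
  have gen : ∀ e : Fin 2 → ℤ, (∀ v, Good v → F (v + (7 : ℤ) • e) = F v) →
      ∀ (n : ℤ) (v : Fin 2 → ℤ), Good v → F (v + (7 : ℤ) • (n • e)) = F v := by
    intro e he n
    induction n using Int.induction_on with
    | zero => intro v _; simp
    | succ i ih =>
      intro v hv
      rw [add_smul, one_smul, smul_add, ← add_assoc, he _ (hv.add _), ih v hv]
    | pred i ih =>
      intro v hv
      have h3 := he (v + (7 : ℤ) • ((-(i : ℤ) - 1) • e)) (hv.add _)
      rw [← h3, ← ih v hv]
      congr 1
      module
  have e1 : u = u 0 • ![1, 0] + u 1 • ![0, 1] := by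
    ext i; fin_cases i <;> simp
  rw [e1, smul_add, ← add_assoc, gen _ (fun v hv => funext fun τ => F_shift_right hv τ) _ _ (hv.add _),
    gen _ (fun v hv => F_shift_left hv) _ _ hv]

lemma F_congr {v w : Fin 2 → ℤ} (hv : Good v) (h0 : (7 : ℤ) ∣ w 0 - v 0) (h1 : (7 : ℤ) ∣ w 1 - v 1) :
    F w = F v := by
  obtain ⟨a, ha⟩ := h0
  obtain ⟨b, hb⟩ := h1
  rw [← F_shift hv ![a, b]]
  congr 1
  ext i; fin_cases i <;> simp <;> omega

lemma F_periodic {v : Fin 2 → ℤ} (hv : Good v) (τ : ℍ) : F v ((7 : ℝ) +ᵥ τ) = F v τ := by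
  have hM : (ModularGroup.T ^ (7 : ℤ)).1 = !![1, 7; 0, 1] := ModularGroup.coe_T_zpow 7
  have hsm : (ModularGroup.T ^ (7 : ℤ)) • τ = (7 : ℝ) +ᵥ τ := by
    rw [UpperHalfPlane.modular_T_zpow_smul]; norm_num
  generalize ModularGroup.T ^ (7 : ℤ) = γ at hM hsm
  have h := congrFun (F_slash γ v) τ
  rw [SL_slash_apply] at h
  have hd : denom γ τ = 1 := by
    simp [denom, hM]
  rw [hd, one_zpow, mul_one, hsm, hM] at h
  rw [h]
  refine congrFun (F_congr hv ?_ ?_) τ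
  · simp [Matrix.vecMul, dotProduct, Fin.sum_univ_two]
  · simp [Matrix.vecMul, dotProduct, Fin.sum_univ_two]

lemma re_invQ (q : ℂ) : |(Function.Periodic.invQParam 7 q).re| ≤ 4 := by
  have h : (Function.Periodic.invQParam 7 q).re = 7 / (2 * Real.pi) * q.arg := by
    have : Function.Periodic.invQParam 7 q = ((7 / (2 * Real.pi) : ℝ) : ℂ) * (-Complex.I * Complex.log q) := by
      unfold Function.Periodic.invQParam
      push_cast
      have hI : (2 * (Real.pi : ℂ) * Complex.I) ≠ 0 := two_pi_I_ne_zero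
      have hp : (Real.pi : ℂ) ≠ 0 := by exact_mod_cast Real.pi_ne_zero
      field_simp
      ring_nf
      simp
    rw [this, re_ofReal_mul]
    simp [Complex.log_im]
  rw [h, abs_mul, abs_of_pos (by positivity)]
  have := Complex.abs_arg_le_pi q
  calc _ ≤ 7 / (2 * Real.pi) * Real.pi := by gcongr
    _ = 7 / 2 := by field_simp
    _ ≤ 4 := by norm_num

lemma F_poly_bound {v : Fin 2 → ℤ} (hv : Good v) : ∃ C : ℝ, ∀ τ : ℍ, |τ.re| ≤ 4 → 1 ≤ τ.im →
    ‖F v τ‖ ≤ C * τ.im ^ 2 := by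
  refine ⟨(5 * (|(v 0 : ℝ)| + |(v 1 : ℝ)|)) ^ 2 * ((r ⟨⟨4, 1⟩, one_pos⟩)⁻¹) ^ 3 * ∑' l, bd v l,
    fun τ h1 h2 => ?_⟩
  have hb := F_bound hv τ (r_pos ⟨⟨4, 1⟩, one_pos⟩)
    (r_lower_bound_on_verticalStrip τ one_pos ⟨h1, h2⟩)
  have hS : 0 ≤ ∑' l, bd v l := tsum_nonneg fun l => bd_nonneg v l
  have hr := r_pos ⟨⟨4, 1⟩, one_pos⟩
  have he : ‖ev v τ‖ ≤ 5 * (|(v 0 : ℝ)| + |(v 1 : ℝ)|) * τ.im := by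
    have hτ : ‖(τ : ℂ)‖ ≤ 5 * τ.im := by
      refine (Complex.norm_le_abs_re_add_abs_im _).trans ?_
      rw [UpperHalfPlane.coe_re, UpperHalfPlane.coe_im, abs_of_pos τ.im_pos]
      linarith
    calc ‖ev v τ‖ ≤ ‖(v 0 : ℂ) * τ‖ + ‖(v 1 : ℂ)‖ := norm_add_le _ _
      _ = |(v 0 : ℝ)| * ‖(τ : ℂ)‖ + |(v 1 : ℝ)| := by
        rw [norm_mul, Complex.norm_intCast, Complex.norm_intCast]
      _ ≤ |(v 0 : ℝ)| * (5 * τ.im) + |(v 1 : ℝ)| * (5 * τ.im) := by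
        gcongr
        exact le_mul_of_one_le_right (abs_nonneg _) (by linarith)
      _ = _ := by ring
  calc _ ≤ _ := hb
    _ ≤ (5 * (|(v 0 : ℝ)| + |(v 1 : ℝ)|) * τ.im) ^ 2 * ((r ⟨⟨4, 1⟩, one_pos⟩)⁻¹) ^ 3 * ∑' l, bd v l := by
      gcongr
    _ = _ := by ring

lemma F_bdd {v : Fin 2 → ℤ} (hv : Good v) : IsBoundedAtImInfty (F v) := by
  have h7 : (0 : ℝ) < 7 := by norm_num
  have hper : Function.Periodic (F v ∘ ofComplex) ((7 : ℝ) : ℂ) := by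
    intro w
    by_cases hw : 0 < im w
    · have : 0 < im (w + (7 : ℝ)) := by simpa using hw
      simp only [Function.comp_apply, ofComplex_apply_of_im_pos this, ofComplex_apply_of_im_pos hw]
      rw [← F_periodic hv ⟨w, hw⟩]
      congr 1
      ext
      simp [add_comm]
    · have : im (w + (7 : ℝ)) ≤ 0 := by simpa using hw
      simp only [Function.comp_apply, ofComplex_apply_of_im_nonpos this,
        ofComplex_apply_of_im_nonpos (not_lt.mp hw)]
  have hhol : ∀ᶠ z in comap im atTop, DifferentiableAt ℂ (F v ∘ ofComplex) z := by
    have h := UpperHalfPlane.mdifferentiable_iff.mp (F_mdiff hv)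
    have : ∀ᶠ z : ℂ in comap im atTop, 0 < z.im := tendsto_comap.eventually (eventually_gt_atTop 0)
    filter_upwards [this] with z hz
    exact h.differentiableAt (isOpen_upperHalfPlaneSet.mem_nhds hz)
  set c := Function.Periodic.cuspFunction 7 (F v ∘ ofComplex) with hc
  have hcd := Function.Periodic.eventually_differentiableAt_cuspFunction_nhds_ne_zero h7 hper hhol
  have hq := Function.Periodic.invQParam_tendsto h7
  obtain ⟨C, hC⟩ := F_poly_bound hv
  have hlim : Tendsto (fun y : ℝ => C * (y ^ 2 / Real.exp (2 * Real.pi / 7 * y))) atTop (𝓝 0) := by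
    have := (isLittleO_pow_exp_pos_mul_atTop 2 (b := 2 * Real.pi / 7) (by positivity)).tendsto_div_nhds_zero
    simpa using this.const_mul C
  have ho1 : c =o[𝓝[≠] 0] fun q : ℂ => (q - 0)⁻¹ := by
    rw [Asymptotics.isLittleO_iff_tendsto']
    · refine squeeze_zero_norm' ?_ ((hlim.comp tendsto_comap).comp hq)
      have hev : ∀ᶠ q in 𝓝[≠] (0 : ℂ), 1 ≤ (Function.Periodic.invQParam 7 q).im :=
        (tendsto_comap.comp hq).eventually (eventually_ge_atTop 1)
      filter_upwards [hev, self_mem_nhdsWithin] with q hq1 hq0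
      have hpos : 0 < (Function.Periodic.invQParam 7 q).im := by linarith
      have h1 : c q = F v ⟨_, hpos⟩ := by
        rw [hc, Function.Periodic.cuspFunction_eq_of_nonzero _ _ hq0, Function.comp_apply,
          ofComplex_apply_of_im_pos hpos]
      have h2 : ‖q‖ = Real.exp (-2 * Real.pi * (Function.Periodic.invQParam 7 q).im / 7) := by
        rw [← Function.Periodic.norm_qParam, Function.Periodic.qParam_right_inv h7.ne' hq0]
      rw [sub_zero, div_inv_eq_mul, norm_mul, h1, h2]
      have h3 := hC ⟨_, hpos⟩ (re_invQ q) hq1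
      have h4 : Real.exp (-2 * Real.pi * (Function.Periodic.invQParam 7 q).im / 7) =
          (Real.exp (2 * Real.pi / 7 * (Function.Periodic.invQParam 7 q).im))⁻¹ := by
        rw [← Real.exp_neg]; congr 1; ring
      rw [h4]
      simp only [Function.comp_apply]
      rw [← mul_div_assoc, div_eq_mul_inv]
      exact mul_le_mul_of_nonneg_right h3 (by positivity)
    · filter_upwards [self_mem_nhdsWithin] with q hq0 h
      simp at h
      exact absurd h hq0
  have ho2 : (fun _ : ℂ => c 0) =o[𝓝[≠] 0] fun q : ℂ => (q - 0)⁻¹ := by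
    rw [Asymptotics.isLittleO_const_left]
    right
    have h0 : Tendsto (fun x : ℂ => ‖x‖⁻¹) (𝓝[≠] 0) atTop :=
      (tendsto_norm_nhdsNE_zero (E := ℂ)).inv_tendsto_nhdsGT_zero
    simpa [Function.comp_def] using h0
  have hlimc := Complex.tendsto_limUnder_of_differentiable_on_punctured_nhds_of_isLittleO hcd (ho1.sub ho2)
  have hfin := (hlimc.comp (Function.Periodic.qParam_tendsto h7)).comp tendsto_coe_atImInfty
  have : ((c ∘ Function.Periodic.qParam 7) ∘ UpperHalfPlane.coe) = F v := by
    ext1 τ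
    simp only [Function.comp_apply, hc]
    rw [Function.Periodic.eq_cuspFunction h7.ne' hper]
    simp
  rw [this] at hfin
  exact hfin.isBigO_one ℝ

/-- Points tending to `i∞`. -/
noncomputable def pt (n : ℕ) : ℍ := ⟨⟨0, n + 1⟩, by positivity⟩

/-- Terms of the constant term. -/
noncomputable def tm (d : ℤ) (n : ℤ) : ℝ :=
  (d : ℝ) ^ 2 / ((7 * n + d) * (7 * n + 2 * d) * (7 * n + 3 * d))

/-- Constant term. -/
noncomputable def ct (d : ℤ) : ℝ := ∑' n : ℤ, tm d n

lemma good_zero {d : ℤ} (hd : ¬ (7 : ℤ) ∣ d) : Good ![0, d] := by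
  intro h; exact hd (by simpa using h.2)

lemma T_zero (d : ℤ) (l : Fin 2 → ℤ) (hl : l 0 = 0) (τ : ℍ) : T ![0, d] l τ = ((tm d (l 1) : ℝ) : ℂ) := by
  simp [T, ev, tm, hl]

lemma F_lim {d : ℤ} (hd : ¬ (7 : ℤ) ∣ d) :
    Tendsto (fun n => F ![0, d] (pt n)) atTop (𝓝 ((ct d : ℝ) : ℂ)) := by
  have hg := good_zero hd
  have hct : ((ct d : ℝ) : ℂ) = ∑' l : Fin 2 → ℤ, if l 0 = 0 then ((tm d (l 1) : ℝ) : ℂ) else 0 := by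
    have hinj : Function.Injective fun n : ℤ => (![0, n] : Fin 2 → ℤ) := by
      intro a b h; simpa using congrFun h 1
    rw [ct, Complex.ofReal_tsum, ← hinj.tsum_eq]
    · simp
    · intro l hl
      refine ⟨l 1, ?_⟩
      have : l 0 = 0 := by
        by_contra h
        simp [h] at hl
      ext i; fin_cases i <;> simp [this]
  rw [hct]
  unfold F
  apply tendsto_tsum_of_dominated_convergence
    (bound := fun l => |(d : ℝ)| ^ 2 * ((r ⟨⟨0, 1⟩, one_pos⟩)⁻¹) ^ 3 * bd ![0, d] l)
    ((summable_bd _).mul_left _)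
  · intro l
    by_cases hl : l 0 = 0
    · simp only [T_zero d l hl, hl, if_true]
      exact tendsto_const_nhds
    · simp only [hl, if_false]
      have hlow : ∀ (n : ℕ) (j : ℤ), (n : ℝ) + 1 ≤ ‖ev ((7 : ℤ) • l + j • ![0, d]) (pt n)‖ := by
        intro n j
        have h1 := Complex.abs_im_le_norm (ev ((7 : ℤ) • l + j • ![0, d]) (pt n))
        have h2 : (ev ((7 : ℤ) • l + j • ![0, d]) (pt n)).im = 7 * (l 0) * (n + 1) := by
          simp [ev, pt]
        rw [h2, abs_mul, abs_mul, abs_of_pos (show (0 : ℝ) < n + 1 by positivity)] at h1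
        have h3 : (1 : ℝ) ≤ |(l 0 : ℝ)| := by exact_mod_cast Int.one_le_abs hl
        have h4 : |(7 : ℝ)| = 7 := by norm_num
        rw [h4] at h1
        have h5 : (0 : ℝ) < n + 1 := by positivity
        nlinarith
      have hz : Tendsto (fun n : ℕ => |(d : ℝ)| ^ 2 * (1 / ((n : ℝ) + 1))) atTop (𝓝 0) := by
        have h0 := (tendsto_one_div_add_atTop_nhds_zero_nat (𝕜 := ℝ)).const_mul (|(d : ℝ)| ^ 2)
        rwa [mul_zero] at h0
      refine squeeze_zero_norm (fun n => ?_) hz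
      have h1 := hlow n 1
      have h2 := hlow n 2
      have h3 := hlow n 3
      have hn : (1 : ℝ) ≤ n + 1 := by linarith [(Nat.cast_nonneg n : (0 : ℝ) ≤ n)]
      have hev : ev ![0, d] (pt n) = (d : ℂ) := by simp [ev]
      unfold T
      rw [norm_div, norm_pow, norm_mul, norm_mul, hev, Complex.norm_intCast, div_eq_mul_one_div]
      gcongr
      calc (n : ℝ) + 1 = (n + 1) * 1 * 1 := by ring
        _ ≤ _ := by gcongr <;> linarith
  · refine Eventually.of_forall fun n l => ?_
    have hs : pt n ∈ verticalStrip 0 1 := by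
      constructor <;> simp [pt, UpperHalfPlane.re, UpperHalfPlane.im]
    have h := T_bound hg l (pt n) (r_pos ⟨⟨0, 1⟩, one_pos⟩)
      (r_lower_bound_on_verticalStrip (pt n) one_pos hs)
    have hev : ev ![0, d] (pt n) = (d : ℂ) := by simp [ev]
    rwa [hev, Complex.norm_intCast] at h

lemma sq_sum : HasSum (fun n : ℤ => 1 / (n : ℝ) ^ 2) (Real.pi ^ 2 / 3) := by
  have h := hasSum_zeta_two
  have h2 := HasSum.of_nat_of_neg (f := fun n : ℤ => 1 / (n : ℝ) ^ 2) (by simpa using h) (by simpa using h)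
  have e : Real.pi ^ 2 / 6 + Real.pi ^ 2 / 6 - 1 / ((0 : ℤ) : ℝ) ^ 2 = Real.pi ^ 2 / 3 := by
    simp; ring
  rwa [e] at h2

lemma tm_bound {d n : ℤ} (hd : 1 ≤ d) (hd3 : d ≤ 3) (hn : n ∉ ({-1, 0, 1} : Finset ℤ)) :
    ‖tm d n‖ ≤ 1 / 10 * (1 / (n : ℝ) ^ 2) := by
  have hn' : 2 ≤ |n| := by
    simp at hn
    rcases abs_cases n with h | h <;> omega
  have hu : 4 * |n| ≤ |7 * n + 2 * d| := by
    rcases abs_cases n with h | h <;> rcases abs_cases (7 * n + 2 * d) with h' | h' <;> omega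
  have hn'' : (2 : ℝ) ≤ |(n : ℝ)| := by exact_mod_cast hn'
  have hu' : 4 * |(n : ℝ)| ≤ |7 * (n : ℝ) + 2 * d| := by exact_mod_cast hu
  have hd' : (1 : ℝ) ≤ d := by exact_mod_cast hd
  have hd3' : (d : ℝ) ≤ 3 := by exact_mod_cast hd3
  have e : ((7 * (n : ℝ) + d) * (7 * n + 2 * d) * (7 * n + 3 * d)) =
      (7 * n + 2 * d) * ((7 * n + 2 * d) ^ 2 - d ^ 2) := by ring
  unfold tm
  rw [e, norm_div, norm_mul, Real.norm_eq_abs, Real.norm_eq_abs, Real.norm_eq_abs]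
  rw [← sq_abs (7 * (n : ℝ) + 2 * d), ← sq_abs (n : ℝ)]
  set u := |7 * (n : ℝ) + 2 * d|
  set m := |(n : ℝ)|
  have hd9 : (d : ℝ) ^ 2 ≤ 9 := by nlinarith
  have hpos : 0 < u ^ 2 - (d : ℝ) ^ 2 := by nlinarith
  rw [abs_of_pos hpos, abs_of_pos (by positivity)]
  rw [show (1 : ℝ) / 10 * (1 / m ^ 2) = 1 / (10 * m ^ 2) by field_simp]
  rw [div_le_div_iff₀ (by nlinarith) (by positivity)]
  have h1 : 8 ≤ u := by linarith
  have h2 : 8 * (u ^ 2 - (d : ℝ) ^ 2) ≤ u * (u ^ 2 - (d : ℝ) ^ 2) := by nlinarith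
  nlinarith

lemma ct_bound {d : ℤ} (hd : 1 ≤ d) (hd3 : d ≤ 3) :
    |ct d - (tm d (-1) + tm d 0 + tm d 1)| ≤ 0.13 := by
  have hs : Summable (tm d) := by
    rw [← (({-1, 0, 1} : Finset ℤ)).summable_compl_iff]
    exact Summable.of_norm_bounded ((sq_sum.summable.mul_left (1 / 10)).subtype _)
      fun n => tm_bound hd hd3 n.2
  have h1 := hs.sum_add_tsum_compl (s := {-1, 0, 1})
  have h2 := sq_sum.summable.sum_add_tsum_compl (s := {-1, 0, 1})
  have h3 : ‖∑' n : (({-1, 0, 1} : Finset ℤ) : Set ℤ)ᶜ.Elem, tm d n‖ ≤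
      1 / 10 * ∑' n : (({-1, 0, 1} : Finset ℤ) : Set ℤ)ᶜ.Elem, 1 / ((n : ℤ) : ℝ) ^ 2 := by
    rw [← tsum_mul_left]
    exact tsum_of_norm_bounded ((sq_sum.summable.mul_left (1 / 10)).subtype _).hasSum
      fun n => tm_bound hd hd3 n.2
  rw [sq_sum.tsum_eq] at h2
  have hpi : Real.pi ^ 2 ≤ 9.87 := by
    have := Real.pi_lt_d4
    nlinarith [Real.pi_pos]
  rw [Finset.sum_insert (by decide), Finset.sum_insert (by decide), Finset.sum_singleton] at h1 h2
  rw [Real.norm_eq_abs] at h3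
  have h4 : ct d - (tm d (-1) + tm d 0 + tm d 1) = ∑' n : (({-1, 0, 1} : Finset ℤ) : Set ℤ)ᶜ.Elem, tm d n := by
    rw [ct, ← h1]; ring
  rw [h4]
  refine h3.trans ?_
  norm_num at h2 ⊢
  linarith

lemma det_ne : ct 3 ^ 3 - ct 1 ^ 3 - ct 2 ^ 3 - 3 * ct 1 * ct 2 * ct 3 ≠ 0 := by
  have h1 := abs_le.mp (ct_bound (d := 1) (by norm_num) (by norm_num))
  have h2 := abs_le.mp (ct_bound (d := 2) (by norm_num) (by norm_num))
  have h3 := abs_le.mp (ct_bound (d := 3) (by norm_num) (by norm_num))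
  norm_num [tm] at h1 h2 h3
  have e : ct 3 ^ 3 - ct 1 ^ 3 - ct 2 ^ 3 - 3 * ct 1 * ct 2 * ct 3 = (ct 3 - ct 1 - ct 2) *
    ((ct 1 - ct 2) ^ 2 + (ct 2 + ct 3) ^ 2 + (ct 1 + ct 3) ^ 2) / 2 := by ring
  rw [e]
  have a1 : 0 < ct 3 - ct 1 - ct 2 := by linarith
  have a2 : 0 < ct 1 + ct 3 := by linarith
  positivity

/-- The weight one forms. -/
noncomputable def Fform (d : ℤ) (hd : ¬ (7 : ℤ) ∣ d) : ModularForm G7 1 where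
  toFun := F ![0, d]
  slash_action_eq' A hA := by
    obtain ⟨A, hA, rfl⟩ := hA
    have hA' : A ∈ CongruenceSubgroup.Gamma1 7 := hA
    rw [CongruenceSubgroup.Gamma1_mem] at hA'
    obtain ⟨-, h11, h10⟩ := hA'
    have h := F_slash A ![0, d]
    rw [F_congr (w := Matrix.vecMul ![0, d] A.1) (v := ![0, d]) (good_zero hd)] at h
    · simpa [Matrix.SpecialLinearGroup.mapGL, ← SL_slash] using h
    · have := (ZMod.intCast_zmod_eq_zero_iff_dvd (A 1 0) 7).mp h10
      simpa [Matrix.vecMul, dotProduct, Fin.sum_univ_two] using this.mul_left d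
    · have h11' : ((A 1 1 : ℤ) : ZMod 7) = ((1 : ℤ) : ZMod 7) := by simpa using h11
      have := (ZMod.intCast_eq_intCast_iff_dvd_sub 1 (A 1 1) 7).mp h11'.symm
      have h2 := this.mul_left d
      simpa [Matrix.vecMul, dotProduct, Fin.sum_univ_two, mul_sub] using h2
  holo' := F_mdiff (good_zero hd)
  bdd_at_cusps' {c} hc := by
    rw [Subgroup.IsArithmetic.isCusp_iff_isCusp_SL2Z] at hc
    rw [OnePoint.isBoundedAt_iff_forall_SL2Z hc]
    intro γ _
    have h := F_bdd ((good_zero hd).vecMul γ)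
    rw [← F_slash] at h
    exact h

lemma F_diamond (γ : SL(2, ℤ)) (h : γ 1 0 = 7) (d e : ℤ) (he : ¬ (7 : ℤ) ∣ e)
    (hde : (7 : ℤ) ∣ d * γ 1 1 - e) : F ![0, d] ∣[(1 : ℤ)] γ = F ![0, e] := by
  rw [F_slash]
  apply F_congr (good_zero he)
  · simp [Matrix.vecMul, dotProduct, Fin.sum_univ_two, h]
  · simpa [Matrix.vecMul, dotProduct, Fin.sum_univ_two] using hde

lemma F_zero_neg (d e : ℤ) (he : ¬ (7 : ℤ) ∣ e) (hde : (7 : ℤ) ∣ d + e) (τ : ℍ) :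
    F ![0, d] τ = - F ![0, e] τ := by
  rw [← F_neg]
  refine congrFun (F_congr ?_ ?_ ?_) τ
  · intro h; exact he (by simpa using h.2)
  · simp
  · simpa using hde

lemma F_indep (a b c : ℂ) (h : ∀ τ, a * F ![0, 1] τ + b * F ![0, 2] τ + c * F ![0, 3] τ = 0) :
    a = 0 ∧ b = 0 ∧ c = 0 := by
  have n1 : ¬ (7 : ℤ) ∣ 1 := by decide
  have n2 : ¬ (7 : ℤ) ∣ 2 := by decide
  have n3 : ¬ (7 : ℤ) ∣ 3 := by decide
  have l1 := F_lim n1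
  have l2 := F_lim n2
  have l3 := F_lim n3
  have hgen : ∀ (γ : SL(2, ℤ)) (τ : ℍ), a * (F ![0, 1] ∣[(1 : ℤ)] γ) τ + b * (F ![0, 2] ∣[(1 : ℤ)] γ) τ
      + c * (F ![0, 3] ∣[(1 : ℤ)] γ) τ = 0 := by
    intro γ τ
    simp only [SL_slash_apply]
    have := h (γ • τ)
    linear_combination this * denom γ τ ^ (-1 : ℤ)
  let g2 : SL(2, ℤ) := ⟨!![4, 1; 7, 2], by simp [Matrix.det_fin_two]⟩
  let g3 : SL(2, ℤ) := ⟨!![5, 2; 7, 3], by simp [Matrix.det_fin_two]⟩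
  have g20 : g2 1 0 = 7 := rfl
  have g21 : g2 1 1 = 2 := rfl
  have g30 : g3 1 0 = 7 := rfl
  have g31 : g3 1 1 = 3 := rfl
  have E1 : ((a * ct 1 + b * ct 2 + c * ct 3 : ℂ)) = 0 := by
    have hl := ((l1.const_mul a).add (l2.const_mul b)).add (l3.const_mul c)
    simp only [h] at hl
    exact tendsto_nhds_unique hl tendsto_const_nhds
  have E2 : ((a * ct 2 - b * ct 3 - c * ct 1 : ℂ)) = 0 := by
    have hl := ((l2.const_mul a).sub (l3.const_mul b)).sub (l1.const_mul c)
    have h0 : ∀ τ, a * F ![0, 2] τ - b * F ![0, 3] τ - c * F ![0, 1] τ = 0 := by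
      intro τ
      have := hgen g2 τ
      rw [F_diamond g2 g20 1 2 n2 (by rw [g21]; decide), F_diamond g2 g20 2 4 (by decide) (by rw [g21]; decide),
        F_diamond g2 g20 3 6 (by decide) (by rw [g21]; decide), F_zero_neg 4 3 n3 (by decide),
        F_zero_neg 6 1 n1 (by decide)] at this
      linear_combination this
    simp only [h0] at hl
    exact tendsto_nhds_unique hl tendsto_const_nhds
  have E3 : ((a * ct 3 - b * ct 1 + c * ct 2 : ℂ)) = 0 := by
    have hl := ((l3.const_mul a).sub (l1.const_mul b)).add (l2.const_mul c)
    have h0 : ∀ τ, a * F ![0, 3] τ - b * F ![0, 1] τ + c * F ![0, 2] τ = 0 := by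
      intro τ
      have := hgen g3 τ
      rw [F_diamond g3 g30 1 3 n3 (by rw [g31]; decide), F_diamond g3 g30 2 6 (by decide) (by rw [g31]; decide),
        F_diamond g3 g30 3 2 (by decide) (by rw [g31]; decide), F_zero_neg 6 1 n1 (by decide)] at this
      linear_combination this
    simp only [h0] at hl
    exact tendsto_nhds_unique hl tendsto_const_nhds
  have hD : ((ct 3 : ℂ) ^ 3 - ct 1 ^ 3 - ct 2 ^ 3 - 3 * ct 1 * ct 2 * ct 3) ≠ 0 := by
    exact_mod_cast det_ne
  generalize (ct 1 : ℂ) = p at *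
  generalize (ct 2 : ℂ) = q at *
  generalize (ct 3 : ℂ) = r at *
  refine ⟨?_, ?_, ?_⟩ <;> refine (mul_eq_zero.mp ?_).resolve_right hD
  · linear_combination (-r * q - p ^ 2) * E1 - (q ^ 2 + r * p) * E2 + (r ^ 2 - p * q) * E3
  · linear_combination -(q ^ 2 + p * r) * E1 + (p * q - r ^ 2) * E2 + (p ^ 2 + q * r) * E3
  · linear_combination (r ^ 2 - p * q) * E1 + (p ^ 2 + q * r) * E2 - (p * r + q ^ 2) * E3

lemma three7 : 3 ≤ Module.finrank ℂ (ModularForm G7 ((1 : ℕ) : ℤ)) := by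
  have hfin : Module.Finite ℂ (ModularForm G7 ((1 : ℕ) : ℤ)) := by
    let φ : ModularForm G7 ((1 : ℕ) : ℤ) →ₗ[ℂ] (Fin 3 → ℂ) :=
      { toFun := fun f i => (UpperHalfPlane.qExpansion 1 f).coeff i
        map_add' := fun f g => by
          ext i
          simp [ModularForm.qExpansion_add one_pos one_mem_periods]
        map_smul' := fun c f => by
          ext i
          simp [ModularForm.qExpansion_smul one_pos one_mem_periods] }
    refine Module.Finite.of_injective φ ?_
    rw [← LinearMap.ker_eq_bot, LinearMap.ker_eq_bot']
    intro f hf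
    apply sturm7
    intro i hi
    exact congrFun hf ⟨i, by omega⟩
  rw [Nat.cast_one] at hfin ⊢
  have hli : LinearIndependent ℂ ![Fform 1 (by decide), Fform 2 (by decide), Fform 3 (by decide)] := by
    rw [Fintype.linearIndependent_iff]
    intro g hg
    rw [Fin.sum_univ_three] at hg
    have := F_indep (g 0) (g 1) (g 2) fun τ => by
      have := DFunLike.congr_fun hg τ
      simpa using! this
    intro i
    fin_cases i
    · exact this.1
    · exact this.2.1
    · exact this.2.2
  simpa using hli.fintype_card_le_finrank

end Eis

theorem modular_forms_Gamma1_7_presentation :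
    (∃ ψ : (MvPolynomial (Fin 3) ℂ ⧸
        (Ideal.span {(X 0 * X 1 + X 1 * X 2 + X 2 * X 0 : MvPolynomial (Fin 3) ℂ)}))
        ≃ₐ[ℂ] (⨁ k : ℤ, ModularForm (CongruenceSubgroup.Gamma1 7) k),
      (∀ (k : ℕ) (f : MvPolynomial (Fin 3) ℂ), f.IsHomogeneous k →
        ∀ j : ℤ, j ≠ (k : ℤ) → ψ (Ideal.Quotient.mk _ f) j = 0) ∧
      (∀ (k : ℕ) (g : ModularForm (CongruenceSubgroup.Gamma1 7) (k : ℤ)),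
        ∃ f : MvPolynomial (Fin 3) ℂ, f.IsHomogeneous k ∧
          ψ (Ideal.Quotient.mk _ f)
            = DirectSum.of (fun k : ℤ => ModularForm (CongruenceSubgroup.Gamma1 7) k)
                (k : ℤ) g)) ∧
    ∀ k : ℕ,
      Module.finrank ℂ (ModularForm (CongruenceSubgroup.Gamma1 7) (k : ℤ)) = 2 * k + 1 := by
  let M : ℤ → Type := fun k => ModularForm G7 k
  let 𝒜 : ℕ → Submodule ℂ (⨁ k : ℤ, ModularForm G7 k) := fun k =>
    LinearMap.range (DirectSum.lof ℂ ℤ (fun k : ℤ => ModularForm G7 k) (k : ℤ))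
  have lof_inj : ∀ k : ℤ, Function.Injective
      (DirectSum.lof ℂ ℤ (fun k : ℤ => ModularForm G7 k) k) := fun k =>
    DirectSum.of_injective (β := fun k : ℤ => ModularForm G7 k) k
  let eqv : ∀ k : ℕ, ModularForm G7 (k : ℤ) ≃ₗ[ℂ] 𝒜 k := fun k =>
    LinearEquiv.ofInjective (DirectSum.lof ℂ ℤ (fun k : ℤ => ModularForm G7 k) (k : ℤ)) (lof_inj k)
  let q0 := ModularForm.qExpansionRingHom (Γ := G7) 1 one_pos one_mem_periods
  let q : (⨁ k : ℤ, ModularForm G7 k) →ₐ[ℂ] PowerSeries ℂ :=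
    { q0 with
      commutes' := by
        intro r
        change q0 (algebraMap ℂ _ r) = _
        rw [Algebra.algebraMap_eq_smul_one, Algebra.algebraMap_eq_smul_one,
          DirectSum.one_def, ← DirectSum.lof_eq_of ℂ, ← map_smul, DirectSum.lof_eq_of]
        erw [ModularForm.qExpansionRingHom_apply]
        have e1 := ModularForm.qExpansion_smul (k := 0) (h := 1) one_pos one_mem_periods r
          (1 : ModularForm G7 0)
        rw [ModularForm.qExpansion_one (Γ := G7)] at e1
        exact e1 }
  have q_of : ∀ (k : ℤ) (g : ModularForm G7 k), q (DirectSum.lof ℂ ℤ (fun k : ℤ => ModularForm G7 k) k g)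
      = UpperHalfPlane.qExpansion 1 g := fun k g => ModularForm.qExpansionRingHom_apply _ _ k g
  obtain ⟨⟨ψ, h1, h2⟩, h3⟩ := abstract_presentation 𝒜 ⟨(1 : ModularForm G7 0), rfl⟩ (by
      rintro m n _ _ ⟨x, rfl⟩ ⟨y, rfl⟩
      rw [DirectSum.lof_eq_of, DirectSum.lof_eq_of, DirectSum.of_mul_of]
      simp only [𝒜]
      rw [Nat.cast_add]
      exact ⟨_, rfl⟩) (by
      rw [eq_top_iff]
      rintro x -
      induction x using DirectSum.induction_on with
      | zero => exact zero_mem _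
      | add x y hx hy => exact add_mem hx hy
      | of i x =>
        by_cases hi : i < 0
        · rw [ModularForm.isZero_of_neg_weight hi x, map_zero]; exact zero_mem _
        · lift i to ℕ using (by omega)
          exact Submodule.mem_iSup_of_mem i ⟨x, rfl⟩)
    (fun k => (DirectSum.lof ℂ ℤ (fun k : ℤ => ModularForm G7 k) k).comp
      (DirectSum.component ℂ ℤ (fun k : ℤ => ModularForm G7 k) k)) (by
      rintro k _ ⟨x, rfl⟩
      rw [LinearMap.comp_apply, DirectSum.component.lof_self]) (by
      rintro k l hkl _ ⟨x, rfl⟩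
      rw [LinearMap.comp_apply, DirectSum.component.of, dif_neg (by simpa using Ne.symm hkl), map_zero])
    q (by
      rintro k _ ⟨x, rfl⟩ hx
      simp only [q_of] at hx
      rw [sturm7 k x hx, map_zero]) (by
      rw [← LinearEquiv.finrank_eq (eqv 1)]
      exact three7)
  refine ⟨⟨ψ, ?_, ?_⟩, ?_⟩
  · intro k f hf j hj
    obtain ⟨g, hg⟩ := h1 k f hf
    rw [← hg, DirectSum.lof_eq_of]
    exact DirectSum.of_eq_of_ne _ _ _ hj
  · intro k g
    exact h2 k _ ⟨g, rfl⟩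
  · intro k
    rw [← h3 k]
    exact LinearEquiv.finrank_eq (eqv k)
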